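/- Let a ∈ ℝ and let U be a nonconstant function meromorphic on all of ℂ satisfying U⁗ + aU″ + U³ − U = 0 on the complement of its poles, such that U has no poles on the real axis, U is real-valued on ℝ, and U(Z) → 0 as Z → ±∞ along ℝ. Then a = 10/√11, and there exist ε ∈ {1, −1} and Z₀ ∈ ℝ such that U(Z) = ε · (4√30/√11) · (1 − tanh²(k(Z − Z₀))) tanh(k(Z − Z₀)) / (1 + tanh²(k(Z − Z₀)))² for all Z ∈ ℝ, where k = 1/(2·11^{1/4}). In other words, up to translation and sign, the stationary Swift–Hohenberg equation has exactly one meromorphic homoclinic solution, and it exists only for a = 10/√11. -/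

import Mathlib

open Complex Filter Topology

noncomputable section

/-- `u` has a pole at `z₀`: `‖u z‖ → ∞` as `z → z₀`, `z ≠ z₀`. -/
def IsPoleAt (u : ℂ → ℂ) (z₀ : ℂ) : Prop :=
  Tendsto (fun z => ‖u z‖) (𝓝[≠] z₀) atTop

/-- `u` is meromorphic on all of `ℂ`: at every point it is either analytic or has a pole. -/
def MeromorphicOnPlane (u : ℂ → ℂ) : Prop :=
  ∀ z : ℂ, AnalyticAt ℂ u z ∨ IsPoleAt u z

/-- The stationary Swift–Hohenberg equation `U⁗ + aU″ + U³ − U = 0` at the point `z`. -/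
def SatisfiesSH (a : ℂ) (U : ℂ → ℂ) (z : ℂ) : Prop :=
  iteratedDeriv 4 U z + a * iteratedDeriv 2 U z + (U z)^3 - U z = 0

/-- `k = 1/(2·11^{1/4})`. -/
def kSH : ℝ := 1 / (2 * (11:ℝ) ^ ((1:ℝ)/4))

/-- The homoclinic profile `(4√30/√11)(1 − tanh²(kZ)) tanh(kZ)/(1 + tanh²(kZ))²`. -/
def USH (Z : ℝ) : ℝ :=
  (4 * Real.sqrt 30 / Real.sqrt 11) *
    ((1 - Real.tanh (kSH * Z)^2) * Real.tanh (kSH * Z)) / (1 + Real.tanh (kSH * Z)^2)^2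

/-- The family `u 0, u 1, u 2, u 3` is a real solution on `s` of the stationary Swift–Hohenberg
equation, written as a first-order system. -/
structure IsJetSolution (a : ℝ) (s : Set ℝ) (u : ℕ → ℝ → ℝ) : Prop where
  hasDerivAt_zero : ∀ x ∈ s, HasDerivAt (u 0) (u 1 x) x
  hasDerivAt_one : ∀ x ∈ s, HasDerivAt (u 1) (u 2 x) x
  hasDerivAt_two : ∀ x ∈ s, HasDerivAt (u 2) (u 3 x) x
  hasDerivAt_three : ∀ x ∈ s, HasDerivAt (u 3) (-a * u 2 x - u 0 x ^ 3 + u 0 x) x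

/-- The component of a jet along the eigenvalue `-μ` of the linearization at `0`. -/
def stableMode (μ ν : ℝ) (u : ℕ → ℝ → ℝ) (x : ℝ) : ℝ :=
  u 3 x + ν ^ 2 * u 1 x - μ * (u 2 x + ν ^ 2 * u 0 x)

/-- The component of a jet along the eigenvalue `μ` of the linearization at `0`. -/
def unstableMode (μ ν : ℝ) (u : ℕ → ℝ → ℝ) (x : ℝ) : ℝ :=
  u 3 x + ν ^ 2 * u 1 x + μ * (u 2 x + ν ^ 2 * u 0 x)

/-- The oscillating component of a jet. -/
def centerMode (μ : ℝ) (u : ℕ → ℝ → ℝ) (x : ℝ) : ℝ := u 2 x - μ ^ 2 * u 0 x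

/-- The derivative of the oscillating component of a jet. -/
def centerModeDeriv (μ : ℝ) (u : ℕ → ℝ → ℝ) (x : ℝ) : ℝ := u 3 x - μ ^ 2 * u 1 x

section Modes

variable {a μ ν : ℝ} {s : Set ℝ} {u : ℕ → ℝ → ℝ} {x : ℝ}

lemma IsJetSolution.hasDerivAt_stableMode (hu : IsJetSolution a s u) (hμν : μ * ν = 1)
    (ha : a = ν ^ 2 - μ ^ 2) (hx : x ∈ s) :
    HasDerivAt (stableMode μ ν u) (-μ * stableMode μ ν u x - u 0 x ^ 3) x := by
  have h := ((hu.hasDerivAt_three x hx).add ((hu.hasDerivAt_one x hx).const_mul (ν ^ 2))).sub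
    (((hu.hasDerivAt_two x hx).add ((hu.hasDerivAt_zero x hx).const_mul (ν ^ 2))).const_mul μ)
  refine h.congr_deriv ?_
  unfold stableMode
  linear_combination (-u 2 x) * ha - u 0 x * (μ * ν + 1) * hμν

lemma IsJetSolution.hasDerivAt_unstableMode (hu : IsJetSolution a s u) (hμν : μ * ν = 1)
    (ha : a = ν ^ 2 - μ ^ 2) (hx : x ∈ s) :
    HasDerivAt (unstableMode μ ν u) (μ * unstableMode μ ν u x - u 0 x ^ 3) x := by
  have h := ((hu.hasDerivAt_three x hx).add ((hu.hasDerivAt_one x hx).const_mul (ν ^ 2))).add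
    (((hu.hasDerivAt_two x hx).add ((hu.hasDerivAt_zero x hx).const_mul (ν ^ 2))).const_mul μ)
  refine h.congr_deriv ?_
  unfold unstableMode
  linear_combination (-u 2 x) * ha - u 0 x * (μ * ν + 1) * hμν

lemma IsJetSolution.hasDerivAt_centerMode (hu : IsJetSolution a s u) (hx : x ∈ s) :
    HasDerivAt (centerMode μ u) (centerModeDeriv μ u x) x :=
  (hu.hasDerivAt_two x hx).sub ((hu.hasDerivAt_zero x hx).const_mul (μ ^ 2))

lemma IsJetSolution.hasDerivAt_centerModeDeriv (hu : IsJetSolution a s u) (hμν : μ * ν = 1)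
    (ha : a = ν ^ 2 - μ ^ 2) (hx : x ∈ s) :
    HasDerivAt (centerModeDeriv μ u) (-ν ^ 2 * centerMode μ u x - u 0 x ^ 3) x := by
  have h := (hu.hasDerivAt_three x hx).sub ((hu.hasDerivAt_one x hx).const_mul (μ ^ 2))
  refine h.congr_deriv ?_
  unfold centerMode
  linear_combination (-u 2 x) * ha - u 0 x * (μ * ν + 1) * hμν

/-- Recovering the solution from its modes. -/
lemma mul_eq_modes (hμ : μ ≠ 0) :
    (μ ^ 2 + ν ^ 2) * u 0 x =
      (unstableMode μ ν u x - stableMode μ ν u x) / (2 * μ) - centerMode μ u x := by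
  unfold unstableMode stableMode centerMode
  field_simp
  ring

end Modes

/-- A function solving `f' = λ f + o(1)` is asymptotically multiplied by `exp (λ h)` under a
translation by `h`. -/
lemma tendsto_translate_sub_exp_mul {f g : ℝ → ℂ} {l : ℂ}
    (hf : ∀ x, HasDerivAt f (l * f x + g x) x) (hg : Tendsto g atTop (𝓝 0)) {h : ℝ} (hh : 0 ≤ h) :
    Tendsto (fun x => f (x + h) - Complex.exp (l * h) * f x) atTop (𝓝 0) := by
  have hexp : ∀ t : ℝ, HasDerivAt (fun t : ℝ => Complex.exp (-l * t)) (Complex.exp (-l * t) * -l) t := by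
    intro t
    have h1 : HasDerivAt (fun t : ℝ => -l * (t : ℂ)) (-l) t := by
      simpa using (Complex.ofRealCLM.hasDerivAt (x := t)).const_mul (-l)
    exact h1.cexp
  obtain ⟨M, hM⟩ := (isCompact_Icc (a := (0 : ℝ)) (b := h)).exists_bound_of_continuousOn
    (f := fun t : ℝ => Complex.exp (-l * t)) (by fun_prop)
  have hM0 : 0 ≤ M := (norm_nonneg _).trans (hM 0 ⟨le_rfl, hh⟩)
  rw [Metric.tendsto_atTop] at hg ⊢
  intro ε hε
  set K := ‖Complex.exp (l * h)‖ * (M * h) + 1 with hK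
  have hKpos : 0 < K := by positivity
  obtain ⟨N, hN⟩ := hg (ε / K) (by positivity)
  refine ⟨N, fun x hx => ?_⟩
  have hder : ∀ t ∈ Set.Icc (0 : ℝ) h, HasDerivWithinAt
      (fun t : ℝ => Complex.exp (-l * t) * f (x + t)) (Complex.exp (-l * t) * g (x + t))
      (Set.Icc 0 h) t := by
    intro t _
    have h2 := (hexp t).mul ((hf (x + t)).comp_const_add x t)
    exact (h2.congr_deriv (by ring)).hasDerivWithinAt
  have hbd : ∀ t ∈ Set.Ico (0 : ℝ) h, ‖Complex.exp (-l * t) * g (x + t)‖ ≤ M * (ε / K) := by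
    intro t ht
    rw [norm_mul]
    have h3 := hN (x + t) (by linarith [ht.1])
    rw [dist_zero_right] at h3
    exact mul_le_mul (hM t ⟨ht.1, ht.2.le⟩) h3.le (norm_nonneg _) hM0
  have h4 := norm_image_sub_le_of_norm_deriv_le_segment' hder hbd h ⟨hh, le_rfl⟩
  have h5 : f (x + h) - Complex.exp (l * h) * f x = Complex.exp (l * h) *
      (Complex.exp (-l * h) * f (x + h) - Complex.exp (-l * (0 : ℝ)) * f (x + 0)) := by
    have : Complex.exp (l * h) * Complex.exp (-l * h) = 1 := by
      rw [← Complex.exp_add]; simp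
    simp only [Complex.ofReal_zero, mul_zero, Complex.exp_zero, add_zero, one_mul, mul_sub]
    rw [← mul_assoc, this, one_mul]
  rw [dist_zero_right, h5, norm_mul]
  calc _ ≤ ‖Complex.exp (l * h)‖ * (M * (ε / K) * (h - 0)) := by gcongr
    _ = (K - 1) * (ε / K) := by rw [hK]; ring
    _ < K * (ε / K) := by gcongr; linarith
    _ = ε := by field_simp

/-- If finitely many functions are asymptotically multiplied by distinct factors under a
translation and their sum tends to zero, then each of them tends to zero. -/
lemma tendsto_zero_of_sum_tendsto_zero {ι : Type*} [DecidableEq ι] (E : ι → ℂ) (h : ℝ) (s : Finset ι)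
    (hE : Set.InjOn E s) (f : ι → ℝ → ℂ)
    (hf : ∀ i ∈ s, Tendsto (fun x => f i (x + h) - E i * f i x) atTop (𝓝 0))
    (hsum : Tendsto (fun x => ∑ i ∈ s, f i x) atTop (𝓝 0)) :
    ∀ i ∈ s, Tendsto (f i) atTop (𝓝 0) := by
  induction s using Finset.induction_on generalizing f with
  | empty => simp
  | insert i s his ih =>
    have hEs : Set.InjOn E s := hE.mono (by simp)
    have key : ∀ j ∈ s, Tendsto (f j) atTop (𝓝 0) := by
      have hne : ∀ j ∈ s, E j - E i ≠ 0 := fun j hj heq => his <| by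
        have := hE (by simp [hj]) (by simp) (sub_eq_zero.1 heq)
        exact this ▸ hj
      have h1 := ih hEs (fun j x => (E j - E i) * f j x) (fun j hj => by
        have := (hf j (Finset.mem_insert_of_mem hj)).const_mul (E j - E i)
        rw [mul_zero] at this
        exact this.congr fun x => by ring) (by
        have h2 : Tendsto (fun x => ∑ j ∈ insert i s, f j (x + h)) atTop (𝓝 0) :=
          hsum.comp (tendsto_atTop_add_const_right _ h tendsto_id)
        have h3 := (h2.sub (hsum.const_mul (E i))).sub
          (tendsto_finsetSum (insert i s) hf)
        simp only [mul_zero, sub_zero, Finset.sum_const_zero] at h3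
        refine h3.congr fun x => ?_
        rw [Finset.mul_sum, ← Finset.sum_sub_distrib, ← Finset.sum_sub_distrib,
          Finset.sum_insert his]
        rw [show f i (x + h) - E i * f i x - (f i (x + h) - E i * f i x) = 0 by ring, zero_add]
        exact Finset.sum_congr rfl fun j _ => by ring)
      intro j hj
      have := (h1 j hj).const_mul (E j - E i)⁻¹
      rw [mul_zero] at this
      exact this.congr fun x => by rw [inv_mul_cancel_left₀ (hne j hj)]
    intro j hj
    rcases Finset.mem_insert.1 hj with rfl | hj
    · have := hsum.sub (tendsto_finsetSum s key)
      simp only [sub_zero, Finset.sum_const_zero] at this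
      refine this.congr fun x => ?_
      rw [Finset.sum_insert his]; ring
    · exact key j hj

section Decay

variable {a μ ν : ℝ} {u : ℕ → ℝ → ℝ}

lemma IsJetSolution.tendsto_modes (hu : IsJetSolution a Set.univ u) (hμ : 0 < μ) (hν : 0 < ν)
    (hμν : μ * ν = 1) (ha : a = ν ^ 2 - μ ^ 2) (h0 : Tendsto (u 0) atTop (𝓝 0)) :
    Tendsto (stableMode μ ν u) atTop (𝓝 0) ∧ Tendsto (unstableMode μ ν u) atTop (𝓝 0) ∧
      Tendsto (centerMode μ u) atTop (𝓝 0) ∧ Tendsto (centerModeDeriv μ u) atTop (𝓝 0) := by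
  have hμ' : (μ : ℂ) ≠ 0 := by exact_mod_cast hμ.ne'
  have hν' : (ν : ℂ) ≠ 0 := by exact_mod_cast hν.ne'
  set l : Fin 4 → ℂ := ![μ, -μ, I * ν, -(I * ν)] with hl
  set m : Fin 4 → ℝ → ℂ := ![fun x => unstableMode μ ν u x, fun x => stableMode μ ν u x,
    fun x => centerModeDeriv μ u x + I * ν * centerMode μ u x,
    fun x => centerModeDeriv μ u x - I * ν * centerMode μ u x] with hm
  set κ : Fin 4 → ℂ := ![1 / (2 * μ), -1 / (2 * μ), -1 / (2 * I * ν), 1 / (2 * I * ν)] with hκ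
  have hX := fun x => (hu.hasDerivAt_stableMode hμν ha (Set.mem_univ x)).ofReal_comp
  have hY := fun x => (hu.hasDerivAt_unstableMode hμν ha (Set.mem_univ x)).ofReal_comp
  have hV := fun x => (hu.hasDerivAt_centerMode (μ := μ) (Set.mem_univ x)).ofReal_comp
  have hV' := fun x => (hu.hasDerivAt_centerModeDeriv hμν ha (Set.mem_univ x)).ofReal_comp
  have hder : ∀ i x, HasDerivAt (m i) (l i * m i x + -(u 0 x : ℂ) ^ 3) x := by
    intro i x
    fin_cases i
    · refine (hY x).congr_deriv ?_
      simp [hl, hm]; ring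
    · refine (hX x).congr_deriv ?_
      simp [hl, hm]; ring
    · refine ((hV' x).add ((hV x).const_mul (I * ν))).congr_deriv ?_
      simp [hl, hm]
      linear_combination (-(ν : ℂ) ^ 2 * centerMode μ u x) * I_sq
    · refine ((hV' x).sub ((hV x).const_mul (I * ν))).congr_deriv ?_
      simp [hl, hm]
      linear_combination (-(ν : ℂ) ^ 2 * centerMode μ u x) * I_sq
  have hg : Tendsto (fun x => -(u 0 x : ℂ) ^ 3) atTop (𝓝 0) := by
    have : Tendsto (fun x => (u 0 x : ℂ)) atTop (𝓝 ((0 : ℝ) : ℂ)) :=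
      (Complex.continuous_ofReal.tendsto 0).comp h0
    simpa using (this.pow 3).neg
  have hh : (0 : ℝ) ≤ 1 / ν := by positivity
  have hinj : Set.InjOn (fun i => Complex.exp (l i * ((1 / ν : ℝ) : ℂ))) (Finset.univ : Finset (Fin 4)) := by
    have e0 : l 0 * ((1 / ν : ℝ) : ℂ) = ((μ / ν : ℝ) : ℂ) := by simp [hl]; ring
    have e1 : l 1 * ((1 / ν : ℝ) : ℂ) = ((-(μ / ν) : ℝ) : ℂ) := by simp [hl]; ring
    have e2 : l 2 * ((1 / ν : ℝ) : ℂ) = ((1 : ℝ) : ℂ) * I := by simp [hl]; field_simp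
    have e3 : l 3 * ((1 / ν : ℝ) : ℂ) = ((-1 : ℝ) : ℂ) * I := by simp [hl]; field_simp
    have hpos : 0 < μ / ν := by positivity
    have n0 : 1 < ‖Complex.exp (l 0 * ((1 / ν : ℝ) : ℂ))‖ := by
      rw [e0, Complex.norm_exp_ofReal]; exact Real.one_lt_exp_iff.2 hpos
    have n1 : ‖Complex.exp (l 1 * ((1 / ν : ℝ) : ℂ))‖ < 1 := by
      rw [e1, Complex.norm_exp_ofReal]; exact Real.exp_lt_one_iff.2 (by linarith)
    have n2 : ‖Complex.exp (l 2 * ((1 / ν : ℝ) : ℂ))‖ = 1 := by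
      rw [e2, Complex.norm_exp_ofReal_mul_I]
    have n3 : ‖Complex.exp (l 3 * ((1 / ν : ℝ) : ℂ))‖ = 1 := by
      rw [e3, Complex.norm_exp_ofReal_mul_I]
    have n23 : Complex.exp (l 2 * ((1 / ν : ℝ) : ℂ)) ≠ Complex.exp (l 3 * ((1 / ν : ℝ) : ℂ)) := by
      rw [e2, e3]
      intro h
      have h1 := congrArg Complex.im h
      rw [Complex.exp_ofReal_mul_I_im, Complex.exp_ofReal_mul_I_im, Real.sin_neg] at h1
      have := Real.sin_pos_of_pos_of_le_one one_pos le_rfl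
      linarith
    intro i _ j _ hij
    have hij' : ‖Complex.exp (l i * ((1 / ν : ℝ) : ℂ))‖ = ‖Complex.exp (l j * ((1 / ν : ℝ) : ℂ))‖ :=
      congrArg norm hij
    fin_cases i <;> fin_cases j <;> first
      | rfl
      | (exact absurd hij n23)
      | (exact absurd hij.symm n23)
      | (exfalso
         simp only [Fin.zero_eta, Fin.mk_one, Fin.reduceFinMk] at hij'
         linarith)
  have hsum : Tendsto (fun x => ∑ i, κ i * m i x) atTop (𝓝 0) := by
    have h1 : Tendsto (fun x => ((μ ^ 2 + ν ^ 2) * u 0 x : ℂ)) atTop (𝓝 0) := by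
      have : Tendsto (fun x => (u 0 x : ℂ)) atTop (𝓝 ((0 : ℝ) : ℂ)) :=
        (Complex.continuous_ofReal.tendsto 0).comp h0
      simpa using this.const_mul ((μ : ℂ) ^ 2 + (ν : ℂ) ^ 2)
    refine h1.congr fun x => ?_
    have h2 := congrArg (fun t : ℝ => (t : ℂ)) (mul_eq_modes (ν := ν) (u := u) (x := x) hμ.ne')
    push_cast at h2
    rw [h2, Fin.sum_univ_four]
    simp only [hκ, hm, Matrix.cons_val]
    field_simp
    ring
  have hlim := tendsto_zero_of_sum_tendsto_zero
    (fun i => Complex.exp (l i * ((1 / ν : ℝ) : ℂ))) (1 / ν) Finset.univ hinj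
    (fun i x => κ i * m i x) (fun i _ => by
      have := (tendsto_translate_sub_exp_mul (hder i) hg hh).const_mul (κ i)
      rw [mul_zero] at this
      exact this.congr fun x => by ring) hsum
  have hκ0 : ∀ i, κ i ≠ 0 := by
    intro i
    fin_cases i <;> simp [hκ, hμ', hν']
  have hlim' : ∀ i, Tendsto (m i) atTop (𝓝 0) := by
    intro i
    have := (hlim i (Finset.mem_univ i)).const_mul (κ i)⁻¹
    rw [mul_zero] at this
    exact this.congr fun x => by rw [inv_mul_cancel_left₀ (hκ0 i)]
  have h1 := hlim' 1
  have h0' := hlim' 0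
  have h2 := hlim' 2
  have hre := (Complex.continuous_re.tendsto 0)
  have him := (Complex.continuous_im.tendsto 0)
  refine ⟨(hre.comp h1).congr fun x => by simp [hm], (hre.comp h0').congr fun x => by simp [hm],
    ?_, (hre.comp h2).congr fun x => by simp [hm]⟩
  have := (him.comp h2).const_mul ν⁻¹
  simp only [Complex.zero_im, mul_zero] at this
  refine this.congr fun x => ?_
  simp [hm]
  field_simp

/-- The conserved energy of the stationary Swift–Hohenberg equation. -/
def jetEnergy (a : ℝ) (u : ℕ → ℝ → ℝ) (x : ℝ) : ℝ :=
  u 1 x * u 3 x - u 2 x ^ 2 / 2 + a * u 1 x ^ 2 / 2 + u 0 x ^ 4 / 4 - u 0 x ^ 2 / 2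

lemma IsJetSolution.tendsto_jet (hu : IsJetSolution a Set.univ u) (hμ : 0 < μ) (hν : 0 < ν)
    (hμν : μ * ν = 1) (ha : a = ν ^ 2 - μ ^ 2) (h0 : Tendsto (u 0) atTop (𝓝 0)) :
    Tendsto (u 1) atTop (𝓝 0) ∧ Tendsto (u 2) atTop (𝓝 0) ∧ Tendsto (u 3) atTop (𝓝 0) := by
  obtain ⟨hX, hY, hV, hV'⟩ := hu.tendsto_modes hμ hν hμν ha h0
  have h2 : Tendsto (u 2) atTop (𝓝 0) := by
    have := hV.add (h0.const_mul (μ ^ 2))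
    simp only [mul_zero, add_zero] at this
    exact this.congr fun x => by unfold centerMode; ring
  have h1 : Tendsto (u 1) atTop (𝓝 0) := by
    have := (((hX.add hY).const_mul (1 / 2)).sub hV').const_mul (μ ^ 2 + ν ^ 2)⁻¹
    simp only [mul_zero, add_zero, sub_zero] at this
    refine this.congr fun x => ?_
    unfold stableMode unstableMode centerModeDeriv
    field_simp
    ring
  refine ⟨h1, h2, ?_⟩
  have := hV'.add (h1.const_mul (μ ^ 2))
  simp only [mul_zero, add_zero] at this
  exact this.congr fun x => by unfold centerModeDeriv; ring

lemma IsJetSolution.jetEnergy_eq_zero (hu : IsJetSolution a Set.univ u) (hμ : 0 < μ) (hν : 0 < ν)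
    (hμν : μ * ν = 1) (ha : a = ν ^ 2 - μ ^ 2) (h0 : Tendsto (u 0) atTop (𝓝 0)) (x : ℝ) :
    jetEnergy a u x = 0 := by
  have hder : ∀ x, HasDerivAt (jetEnergy a u) 0 x := by
    intro x
    have d0 := hu.hasDerivAt_zero x (Set.mem_univ x)
    have d1 := hu.hasDerivAt_one x (Set.mem_univ x)
    have d2 := hu.hasDerivAt_two x (Set.mem_univ x)
    have d3 := hu.hasDerivAt_three x (Set.mem_univ x)
    have h := ((((d1.mul d3).sub ((d2.pow 2).div_const 2)).add
      (((d1.pow 2).const_mul a).div_const 2)).add ((d0.pow 4).div_const 4)).sub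
        ((d0.pow 2).div_const 2)
    refine h.congr_deriv ?_
    norm_num
    ring
  have hconst : ∀ y, jetEnergy a u y = jetEnergy a u x := fun y =>
    is_const_of_deriv_eq_zero (fun z => (hder z).differentiableAt) (fun z => (hder z).deriv) y x
  obtain ⟨h1, h2, h3⟩ := hu.tendsto_jet hμ hν hμν ha h0
  have hlim : Tendsto (jetEnergy a u) atTop (𝓝 0) := by
    have h := ((((h1.mul h3).sub ((h2.pow 2).div_const 2)).add
      (((h1.pow 2).const_mul a).div_const 2)).add ((h0.pow 4).div_const 4)).sub
        ((h0.pow 2).div_const 2)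
    norm_num at h
    exact h
  exact tendsto_nhds_unique (tendsto_const_nhds.congr fun y => (hconst y).symm) hlim

/-- A solution tending to zero eventually decays exponentially, and is controlled by its stable
mode. -/
lemma IsJetSolution.exists_decay (hu : IsJetSolution a Set.univ u) (hμ : 0 < μ) (hν : 0 < ν)
    (hμν : μ * ν = 1) (ha : a = ν ^ 2 - μ ^ 2) (h0 : Tendsto (u 0) atTop (𝓝 0)) :
    ∃ x₀, ∀ x₁ ≥ x₀, ∀ x ≥ x₁,
      u 0 x ^ 2 ≤ 2 * stableMode μ ν u x₁ ^ 2 * Real.exp (-μ * (x - x₁)) := by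
  obtain ⟨hX, hY, -, -⟩ := hu.tendsto_modes hμ hν hμν ha h0
  have hs : 2 ≤ μ ^ 2 + ν ^ 2 := by nlinarith [sq_nonneg (μ - ν)]
  have hsmall : ∀ᶠ x in atTop, u 0 x ^ 2 ≤ min (μ / 3) (1 / (2 * μ ^ 2)) := by
    have := h0.pow 2
    norm_num at this
    exact this.eventually_le_const (by positivity)
  obtain ⟨x₀, hx₀⟩ := eventually_atTop.1 hsmall
  have hS : ∀ x ≥ x₀, 3 * u 0 x ^ 2 ≤ μ := fun x hx => by
    have := (hx₀ x hx).trans (min_le_left _ _); linarith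
  have hS' : ∀ x ≥ x₀, 2 * μ ^ 2 * u 0 x ^ 2 ≤ 1 := fun x hx => by
    have := (hx₀ x hx).trans (min_le_right _ _)
    rw [le_div_iff₀ (by positivity)] at this; linarith
  set X := stableMode μ ν u with hXdef
  set Y := unstableMode μ ν u with hYdef
  have hbound : ∀ x ≥ x₀, u 0 x ^ 2 ≤ X x ^ 2 + Y x ^ 2 := by
    intro x hx
    have hE : X x * Y x + (μ ^ 2 + ν ^ 2) * u 0 x ^ 4 / 2 =
        centerModeDeriv μ u x ^ 2 + ν ^ 2 * centerMode μ u x ^ 2 := by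
      have hE := hu.jetEnergy_eq_zero hμ hν hμν ha h0 x
      simp only [hXdef, hYdef, stableMode, unstableMode, centerMode, centerModeDeriv, jetEnergy]
        at hE ⊢
      rw [ha] at hE
      linear_combination 2 * (μ ^ 2 + ν ^ 2) * hE -
        (μ * ν + 1) * (μ ^ 2 + ν ^ 2) * u 0 x ^ 2 * hμν
    have hm := mul_eq_modes (ν := ν) (u := u) (x := x) hμ.ne'
    rw [← hXdef, ← hYdef] at hm
    set V := centerMode μ u x
    set W := (Y x - X x) / (2 * μ) with hW
    have hWμ : 2 * W = ν * (Y x - X x) := by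
      rw [hW]; field_simp; linear_combination (X x - Y x) * hμν
    have h1 : ((μ ^ 2 + ν ^ 2) * u 0 x) ^ 2 ≤ 2 * W ^ 2 + 2 * V ^ 2 := by
      rw [hm]; nlinarith [sq_nonneg (W + V)]
    have h2 : 2 * W ^ 2 ≤ ν ^ 2 * (X x ^ 2 + Y x ^ 2) := by
      have : 4 * W ^ 2 = ν ^ 2 * (Y x - X x) ^ 2 := by
        linear_combination (2 * W + ν * (Y x - X x)) * hWμ
      nlinarith [mul_nonneg (sq_nonneg ν) (sq_nonneg (X x + Y x))]
    have h3 : V ^ 2 = μ ^ 2 * (ν ^ 2 * V ^ 2) := by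
      linear_combination (-(μ * ν + 1) * V ^ 2) * hμν
    have h4 : ν ^ 2 * V ^ 2 ≤ (X x ^ 2 + Y x ^ 2) / 2 + (μ ^ 2 + ν ^ 2) * u 0 x ^ 4 / 2 := by
      nlinarith [sq_nonneg (centerModeDeriv μ u x), sq_nonneg (X x - Y x)]
    have h5 : 2 * V ^ 2 ≤ μ ^ 2 * ((X x ^ 2 + Y x ^ 2) + (μ ^ 2 + ν ^ 2) * u 0 x ^ 4) := by
      rw [h3]; nlinarith [mul_le_mul_of_nonneg_left h4 (sq_nonneg μ)]
    have h6 : (μ ^ 2 + ν ^ 2) * ((μ ^ 2 + ν ^ 2) * u 0 x ^ 2) ≤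
        (μ ^ 2 + ν ^ 2) * (X x ^ 2 + Y x ^ 2 + μ ^ 2 * u 0 x ^ 4) := by nlinarith
    have h7 := le_of_mul_le_mul_left h6 (by linarith)
    have h8 : 2 * (μ ^ 2 * u 0 x ^ 4) ≤ u 0 x ^ 2 := by
      have := mul_le_mul_of_nonneg_right (hS' x hx) (sq_nonneg (u 0 x))
      nlinarith
    nlinarith [mul_le_mul_of_nonneg_right hs (sq_nonneg (u 0 x)), sq_nonneg (X x), sq_nonneg (Y x)]
  have hdX : ∀ x, HasDerivAt X (-μ * X x - u 0 x ^ 3) x :=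
    fun x => hu.hasDerivAt_stableMode hμν ha (Set.mem_univ x)
  have hdY : ∀ x, HasDerivAt Y (μ * Y x - u 0 x ^ 3) x :=
    fun x => hu.hasDerivAt_unstableMode hμν ha (Set.mem_univ x)
  have hYX : ∀ x ≥ x₀, Y x ^ 2 ≤ X x ^ 2 := by
    have hd : ∀ x, HasDerivAt (fun x => X x ^ 2 - Y x ^ 2)
        (-2 * μ * (X x ^ 2 + Y x ^ 2) + 2 * u 0 x ^ 3 * (Y x - X x)) x := by
      intro x
      refine (((hdX x).pow 2).sub ((hdY x).pow 2)).congr_deriv ?_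
      norm_num; ring
    have hanti : AntitoneOn (fun x => X x ^ 2 - Y x ^ 2) (Set.Ici x₀) := by
      refine antitoneOn_of_deriv_nonpos (convex_Ici x₀)
        (fun x _ => (hd x).continuousAt.continuousWithinAt)
        (fun x _ => (hd x).differentiableAt.differentiableWithinAt) fun x hx => ?_
      rw [interior_Ici] at hx
      rw [(hd x).deriv]
      have hb := hbound x hx.le
      have h3 := hS x hx.le
      have h4 : 2 * u 0 x ^ 3 * (Y x - X x) ≤ u 0 x ^ 2 * (3 * (X x ^ 2 + Y x ^ 2)) := by
        have : 2 * u 0 x * (Y x - X x) ≤ 3 * (X x ^ 2 + Y x ^ 2) := by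
          nlinarith [sq_nonneg (u 0 x - Y x), sq_nonneg (u 0 x + X x)]
        nlinarith [mul_le_mul_of_nonneg_left this (sq_nonneg (u 0 x))]
      nlinarith [mul_le_mul_of_nonneg_right h3 (add_nonneg (sq_nonneg (X x)) (sq_nonneg (Y x))),
        mul_nonneg hμ.le (add_nonneg (sq_nonneg (X x)) (sq_nonneg (Y x)))]
    intro x hx
    have hlim : Tendsto (fun x => X x ^ 2 - Y x ^ 2) atTop (𝓝 0) := by
      simpa using (hX.pow 2).sub (hY.pow 2)
    have := le_of_tendsto hlim (eventually_atTop.2 ⟨x, fun y hy => hanti hx (hx.le.trans hy) hy⟩)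
    linarith
  refine ⟨x₀, fun x₁ hx₁ x hx => ?_⟩
  have hd : ∀ x, HasDerivAt (fun x => X x ^ 2 * Real.exp (μ * (x - x₁)))
      ((-μ * X x ^ 2 - 2 * u 0 x ^ 3 * X x) * Real.exp (μ * (x - x₁))) x := by
    intro x
    have he : HasDerivAt (fun x => Real.exp (μ * (x - x₁))) (Real.exp (μ * (x - x₁)) * (μ * 1)) x :=
      (((hasDerivAt_id x).sub_const x₁).const_mul μ).exp
    refine (((hdX x).pow 2).mul he).congr_deriv ?_
    norm_num; ring
  have hanti : AntitoneOn (fun x => X x ^ 2 * Real.exp (μ * (x - x₁))) (Set.Ici x₀) := by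
    refine antitoneOn_of_deriv_nonpos (convex_Ici x₀)
      (fun x _ => (hd x).continuousAt.continuousWithinAt)
      (fun x _ => (hd x).differentiableAt.differentiableWithinAt) fun x hx => ?_
    rw [interior_Ici] at hx
    rw [(hd x).deriv]
    refine mul_nonpos_of_nonpos_of_nonneg ?_ (Real.exp_pos _).le
    have hb := hbound x hx.le
    have h3 := hS x hx.le
    have h5 := hYX x hx.le
    have h4 : -(2 * u 0 x ^ 3 * X x) ≤ u 0 x ^ 2 * (3 * X x ^ 2) := by
      have : -(2 * u 0 x * X x) ≤ 3 * X x ^ 2 := by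
        nlinarith [sq_nonneg (u 0 x + X x)]
      nlinarith [mul_le_mul_of_nonneg_left this (sq_nonneg (u 0 x))]
    nlinarith [mul_le_mul_of_nonneg_right h3 (sq_nonneg (X x))]
  have h1 := hanti (show x₁ ∈ Set.Ici x₀ from hx₁) (show x ∈ Set.Ici x₀ from hx₁.trans hx) hx
  simp only [sub_self, mul_zero, Real.exp_zero, mul_one] at h1
  have h2 : X x ^ 2 ≤ X x₁ ^ 2 * Real.exp (-μ * (x - x₁)) := by
    have : Real.exp (μ * (x - x₁)) * Real.exp (-μ * (x - x₁)) = 1 := by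
      rw [← Real.exp_add]; simp
    calc X x ^ 2 = X x ^ 2 * Real.exp (μ * (x - x₁)) * Real.exp (-μ * (x - x₁)) := by
          rw [mul_assoc, this, mul_one]
      _ ≤ _ := by gcongr
  have := hbound x (hx₁.trans hx)
  have := hYX x (hx₁.trans hx)
  linarith

end Decay

section Uniqueness

variable {a μ ν : ℝ} {u v : ℕ → ℝ → ℝ}

set_option maxHeartbeats 1000000 in
/-- Two decaying solutions with the same stable mode at `0` coincide on `[0, ∞)`. -/
lemma IsJetSolution.eqOn_of_stableMode_eq (hu : IsJetSolution a (Set.Ici 0) u)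
    (hv : IsJetSolution a (Set.Ici 0) v) (hμ : 0 < μ) (hν : 0 < ν) (hμν : μ * ν = 1)
    (ha : a = ν ^ 2 - μ ^ 2) {η : ℝ} (hη : 5 * η ≤ μ)
    (hbd : ∀ x ≥ 0, u 0 x ^ 2 + u 0 x * v 0 x + v 0 x ^ 2 ≤ η * Real.exp (-μ * x))
    (hX0 : stableMode μ ν u 0 = stableMode μ ν v 0)
    (hXu : Tendsto (stableMode μ ν u) atTop (𝓝 0)) (hXv : Tendsto (stableMode μ ν v) atTop (𝓝 0))
    (hYu : Tendsto (unstableMode μ ν u) atTop (𝓝 0))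
    (hYv : Tendsto (unstableMode μ ν v) atTop (𝓝 0))
    (hVu : Tendsto (centerMode μ u) atTop (𝓝 0)) (hVv : Tendsto (centerMode μ v) atTop (𝓝 0))
    (hVu' : Tendsto (centerModeDeriv μ u) atTop (𝓝 0))
    (hVv' : Tendsto (centerModeDeriv μ v) atTop (𝓝 0)) :
    ∀ x ≥ 0, u 0 x = v 0 x := by
  have hs : 2 ≤ μ ^ 2 + ν ^ 2 := by nlinarith [sq_nonneg (μ - ν)]
  set X : ℝ → ℝ := fun x => stableMode μ ν u x - stableMode μ ν v x with hX
  set Y : ℝ → ℝ := fun x => unstableMode μ ν u x - unstableMode μ ν v x with hY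
  set V : ℝ → ℝ := fun x => centerMode μ u x - centerMode μ v x with hV
  set V' : ℝ → ℝ := fun x => centerModeDeriv μ u x - centerModeDeriv μ v x with hV'
  set d : ℝ → ℝ := fun x => u 0 x - v 0 x with hd
  set q : ℝ → ℝ := fun x => u 0 x ^ 2 + u 0 x * v 0 x + v 0 x ^ 2 with hq
  set A : ℝ → ℝ := fun x => X x ^ 2 with hA
  set B : ℝ → ℝ := fun x => Y x ^ 2 + V' x ^ 2 + ν ^ 2 * V x ^ 2 with hB
  have hA0 : ∀ x, 0 ≤ A x := fun x => sq_nonneg _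
  have hB0 : ∀ x, 0 ≤ B x := fun x => by positivity
  have hq0 : ∀ x, 0 ≤ q x := fun x => by
    simp only [hq]; nlinarith [sq_nonneg (u 0 x + v 0 x), sq_nonneg (u 0 x), sq_nonneg (v 0 x)]
  have hdX : ∀ x ≥ 0, HasDerivAt X (-μ * X x - q x * d x) x := fun x hx => by
    refine ((hu.hasDerivAt_stableMode hμν ha hx).sub
      (hv.hasDerivAt_stableMode hμν ha hx)).congr_deriv ?_
    simp only [hX, hq, hd]; ring
  have hdY : ∀ x ≥ 0, HasDerivAt Y (μ * Y x - q x * d x) x := fun x hx => by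
    refine ((hu.hasDerivAt_unstableMode hμν ha hx).sub
      (hv.hasDerivAt_unstableMode hμν ha hx)).congr_deriv ?_
    simp only [hY, hq, hd]; ring
  have hdV : ∀ x ≥ 0, HasDerivAt V (V' x) x := fun x hx =>
    (hu.hasDerivAt_centerMode hx).sub (hv.hasDerivAt_centerMode hx)
  have hdV' : ∀ x ≥ 0, HasDerivAt V' (-ν ^ 2 * V x - q x * d x) x := fun x hx => by
    refine ((hu.hasDerivAt_centerModeDeriv hμν ha hx).sub
      (hv.hasDerivAt_centerModeDeriv hμν ha hx)).congr_deriv ?_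
    simp only [hV, hq, hd]; ring
  have hdA : ∀ x ≥ 0, HasDerivAt A (-2 * μ * A x - 2 * q x * d x * X x) x := fun x hx => by
    refine ((hdX x hx).pow 2).congr_deriv ?_
    simp only [hA]; norm_num; ring
  have hdB : ∀ x ≥ 0, HasDerivAt B (2 * μ * Y x ^ 2 - 2 * q x * d x * (Y x + V' x)) x :=
    fun x hx => by
    refine ((((hdY x hx).pow 2).add ((hdV' x hx).pow 2)).add
      (((hdV x hx).pow 2).const_mul (ν ^ 2))).congr_deriv ?_
    norm_num; ring
  have hdle : ∀ x, d x ^ 2 ≤ A x + B x := by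
    intro x
    have hm : (μ ^ 2 + ν ^ 2) * d x = (Y x - X x) / (2 * μ) - V x := by
      have h1 := mul_eq_modes (ν := ν) (u := u) (x := x) hμ.ne'
      have h2 := mul_eq_modes (ν := ν) (u := v) (x := x) hμ.ne'
      simp only [hd, hY, hX, hV]
      rw [mul_sub, h1, h2]; ring
    set W := (Y x - X x) / (2 * μ) with hW
    have hWμ : 2 * W = ν * (Y x - X x) := by
      rw [hW]; field_simp; linear_combination (X x - Y x) * hμν
    have h1 : ((μ ^ 2 + ν ^ 2) * d x) ^ 2 ≤ 2 * W ^ 2 + 2 * V x ^ 2 := by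
      rw [hm]; nlinarith [sq_nonneg (W + V x)]
    have h2 : 2 * W ^ 2 ≤ ν ^ 2 * (X x ^ 2 + Y x ^ 2) := by
      have : 4 * W ^ 2 = ν ^ 2 * (Y x - X x) ^ 2 := by
        linear_combination (2 * W + ν * (Y x - X x)) * hWμ
      nlinarith [mul_nonneg (sq_nonneg ν) (sq_nonneg (X x + Y x))]
    have h3 : V x ^ 2 = μ ^ 2 * (ν ^ 2 * V x ^ 2) := by
      linear_combination (-(μ * ν + 1) * V x ^ 2) * hμν
    have h4 : (μ ^ 2 + ν ^ 2) * ((μ ^ 2 + ν ^ 2) * d x ^ 2) ≤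
        (μ ^ 2 + ν ^ 2) * (2 * (A x + B x)) := by
      simp only [hA, hB]
      rw [h3] at h1
      nlinarith [mul_nonneg (sq_nonneg μ) (sq_nonneg (X x)), mul_nonneg (sq_nonneg μ) (sq_nonneg (Y x)),
        mul_nonneg (sq_nonneg ν) (sq_nonneg (X x)), mul_nonneg (sq_nonneg ν) (sq_nonneg (Y x)),
        mul_nonneg (sq_nonneg μ) (sq_nonneg (V' x)), mul_nonneg (sq_nonneg ν) (sq_nonneg (V' x)),
        mul_nonneg (sq_nonneg ν) (mul_nonneg (sq_nonneg ν) (sq_nonneg (V x))),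
        mul_nonneg (sq_nonneg μ) (mul_nonneg (sq_nonneg ν) (sq_nonneg (V x)))]
    have h5 := le_of_mul_le_mul_left h4 (by linarith)
    nlinarith [mul_le_mul_of_nonneg_right hs (sq_nonneg (d x))]
  have hη0 : 0 ≤ η := by
    have h1 := hbd 0 le_rfl
    have h2 := hq0 0
    simp only [hq] at h2
    simpa using h2.trans h1
  have hh : ∀ x ≥ 0, η * Real.exp (-μ * x) ≤ η := fun x hx =>
    mul_le_of_le_one_right hη0 (Real.exp_le_one_iff.2 (by nlinarith))
  set φ : ℝ → ℝ := fun x => Real.exp (-(5 * η / μ) * Real.exp (-μ * x)) with hφ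
  have hφpos : ∀ x, 0 < φ x := fun x => Real.exp_pos _
  have hdφ : ∀ x, HasDerivAt φ (φ x * (5 * (η * Real.exp (-μ * x)))) x := by
    intro x
    have h1 : HasDerivAt (fun x => Real.exp (-μ * x)) (Real.exp (-μ * x) * (-μ * 1)) x :=
      ((hasDerivAt_id x).const_mul (-μ)).exp
    refine (h1.const_mul (-(5 * η / μ))).exp.congr_deriv ?_
    simp only [hφ]
    field_simp
  have hmono : MonotoneOn (fun x => (B x - A x) * φ x) (Set.Ici 0) := by
    refine monotoneOn_of_deriv_nonneg (convex_Ici 0)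
      (fun x hx => (((hdB x hx).sub (hdA x hx)).mul (hdφ x)).continuousAt.continuousWithinAt)
      (fun x hx => (((hdB x (interior_subset hx)).sub (hdA x (interior_subset hx))).mul
        (hdφ x)).differentiableAt.differentiableWithinAt) fun x hx => ?_
    rw [interior_Ici] at hx
    have hx : 0 < x := hx
    have hder : deriv (fun x => (B x - A x) * φ x) x = _ :=
      (((hdB x hx.le).sub (hdA x hx.le)).mul (hdφ x)).deriv
    rw [hder]
    set h := η * Real.exp (-μ * x) with hhdef
    have e1 : q x ≤ h := hbd x hx.le
    have e2 : h ≤ η := hh x hx.le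
    have e3 : 0 ≤ 2 * μ * Y x ^ 2 - 2 * q x * d x * (Y x + V' x) -
        (-2 * μ * A x - 2 * q x * d x * X x) + (B x - A x) * (5 * h) := by
      have e4 : 2 * d x * (Y x + V' x - X x) ≤ 5 * (A x + B x) := by
        have := hdle x
        have e5 : X x ^ 2 + Y x ^ 2 + V' x ^ 2 ≤ A x + B x := by
          simp only [hA, hB]; nlinarith [mul_nonneg (sq_nonneg ν) (sq_nonneg (V x))]
        nlinarith [sq_nonneg (d x - Y x), sq_nonneg (d x - V' x), sq_nonneg (d x + X x)]
      have e6 : q x * (2 * d x * (Y x + V' x - X x)) ≤ h * (5 * (A x + B x)) :=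
        (mul_le_mul_of_nonneg_left e4 (hq0 x)).trans
          (mul_le_mul_of_nonneg_right e1 (by linarith [hA0 x, hB0 x]))
      have e7 : 10 * h * A x ≤ 2 * μ * A x := mul_le_mul_of_nonneg_right (by linarith) (hA0 x)
      have e8 : 0 ≤ 2 * μ * Y x ^ 2 := by positivity
      linarith
    have := mul_nonneg (hφpos x).le e3
    simp only [Pi.sub_apply]
    linarith
  have hlim : Tendsto (fun x => (B x - A x) * φ x) atTop (𝓝 0) := by
    have hXl : Tendsto X atTop (𝓝 0) := by simpa using hXu.sub hXv
    have hYl : Tendsto Y atTop (𝓝 0) := by simpa using hYu.sub hYv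
    have hVl : Tendsto V atTop (𝓝 0) := by simpa using hVu.sub hVv
    have hVl' : Tendsto V' atTop (𝓝 0) := by simpa using hVu'.sub hVv'
    have hBA : Tendsto (fun x => B x - A x) atTop (𝓝 0) := by
      simpa using (((hYl.pow 2).add (hVl'.pow 2)).add ((hVl.pow 2).const_mul (ν ^ 2))).sub (hXl.pow 2)
    refine hBA.zero_mul_isBoundedUnder_le ⟨1, ?_⟩
    refine eventually_map.2 (Eventually.of_forall fun x => ?_)
    simp only [Function.comp, Real.norm_eq_abs, abs_of_pos (hφpos x)]
    refine Real.exp_le_one_iff.2 ?_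
    have : 0 ≤ (5 * η / μ) * Real.exp (-μ * x) := by positivity
    linarith
  have hBA : ∀ x ≥ 0, B x = A x := by
    intro x hx
    have h1 : (B x - A x) * φ x ≤ 0 := ge_of_tendsto hlim
      (eventually_atTop.2 ⟨x, fun y hy => hmono hx (hx.le.trans hy) hy⟩)
    have h2 : (B 0 - A 0) * φ 0 ≤ (B x - A x) * φ x := hmono (Set.mem_Ici.2 le_rfl) hx hx
    have h3 : A 0 = 0 := by simp [hA, hX, hX0]
    have h4 : 0 ≤ (B 0 - A 0) * φ 0 := by
      rw [h3, sub_zero]; exact mul_nonneg (hB0 0) (hφpos 0).le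
    have h5 : (B x - A x) * φ x = 0 := le_antisymm h1 (h4.trans h2)
    have := (mul_eq_zero.1 h5).resolve_right (hφpos x).ne'
    linarith
  have hanti : AntitoneOn A (Set.Ici 0) := by
    refine antitoneOn_of_deriv_nonpos (convex_Ici 0)
      (fun x hx => (hdA x hx).continuousAt.continuousWithinAt)
      (fun x hx => (hdA x (interior_subset hx)).differentiableAt.differentiableWithinAt)
      fun x hx => ?_
    rw [interior_Ici] at hx
    have hx : 0 < x := hx
    rw [(hdA x hx.le).deriv]
    have e1 : q x ≤ η := (hbd x hx.le).trans (hh x hx.le)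
    have e2 : -(2 * d x * X x) ≤ 3 * A x := by
      have h1 := hdle x
      have h2 := hBA x hx.le
      have h3 := sq_nonneg (d x + X x)
      simp only [hA] at h1 h2 ⊢
      linarith [add_sq (d x) (X x)]
    have e3 : q x * -(2 * d x * X x) ≤ η * (3 * A x) :=
      (mul_le_mul_of_nonneg_left e2 (hq0 x)).trans
        (mul_le_mul_of_nonneg_right e1 (by linarith [hA0 x]))
    linarith [mul_le_mul_of_nonneg_right hη (hA0 x), mul_nonneg hμ.le (hA0 x),
      mul_nonneg hη0 (hA0 x)]
  intro x hx
  have h1 : A x ≤ A 0 := hanti (Set.mem_Ici.2 le_rfl) hx hx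
  have h2 : A 0 = 0 := by simp [hA, hX, hX0]
  have h3 := hdle x
  rw [hBA x hx] at h3
  have h4 : d x ^ 2 = 0 := le_antisymm (by linarith) (sq_nonneg _)
  exact sub_eq_zero.1 (pow_eq_zero_iff two_ne_zero |>.1 h4)

end Uniqueness

section StableSeries

/-- The value at `n` of the symbol of the linearized equation, `n⁴μ⁴ + (ν² - μ²)n²μ² - 1` when
`μν = 1`. -/
def linearSymbol (μ ν n : ℝ) : ℝ := (n ^ 2 - 1) * μ ^ 2 * (n ^ 2 * μ ^ 2 + ν ^ 2)

/-- Coefficients of the odd power series in `w = exp (-μ Z)` parametrizing the stable manifold. -/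
def stableCoeff (μ ν : ℝ) : ℕ → ℝ
  | 0 => 1
  | m + 1 => -(∑ p ∈ (Finset.HasAntidiagonal.antidiagonal m).attach, stableCoeff μ ν p.1.1 *
      ∑ r ∈ (Finset.HasAntidiagonal.antidiagonal p.1.2).attach, stableCoeff μ ν r.1.1 * stableCoeff μ ν r.1.2) /
        linearSymbol μ ν (2 * m + 3)
  decreasing_by
  · have := Finset.HasAntidiagonal.mem_antidiagonal.1 p.2; omega
  · have := Finset.HasAntidiagonal.mem_antidiagonal.1 p.2
    have := Finset.HasAntidiagonal.mem_antidiagonal.1 r.2; omega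
  · have := Finset.HasAntidiagonal.mem_antidiagonal.1 p.2
    have := Finset.HasAntidiagonal.mem_antidiagonal.1 r.2; omega

variable {μ ν : ℝ}

lemma stableCoeff_zero : stableCoeff μ ν 0 = 1 := by rw [stableCoeff]

lemma stableCoeff_succ (m : ℕ) : stableCoeff μ ν (m + 1) =
    -(∑ p ∈ Finset.HasAntidiagonal.antidiagonal m, stableCoeff μ ν p.1 *
      ∑ r ∈ Finset.HasAntidiagonal.antidiagonal p.2, stableCoeff μ ν r.1 * stableCoeff μ ν r.2) /
        linearSymbol μ ν (2 * m + 3) := by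
  rw [stableCoeff]
  congr 2
  rw [Finset.sum_attach (Finset.HasAntidiagonal.antidiagonal m) (fun p => stableCoeff μ ν p.1 *
    ∑ r ∈ (Finset.HasAntidiagonal.antidiagonal p.2).attach, stableCoeff μ ν r.1.1 * stableCoeff μ ν r.1.2)]
  refine Finset.sum_congr rfl fun p _ => ?_
  rw [Finset.sum_attach (Finset.HasAntidiagonal.antidiagonal p.2)
    (fun r => stableCoeff μ ν r.1 * stableCoeff μ ν r.2)]

lemma sq_le_linearSymbol (hμν : μ * ν = 1) (m : ℕ) :
    ((m : ℝ) + 1) ^ 2 ≤ linearSymbol μ ν (2 * m + 3) := by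
  have hm : (0 : ℝ) ≤ m := m.cast_nonneg
  have h1 : linearSymbol μ ν (2 * m + 3) =
      ((2 * (m : ℝ) + 3) ^ 2 - 1) * ((2 * m + 3) ^ 2 * μ ^ 4 + 1) := by
    unfold linearSymbol
    linear_combination (((2 * (m : ℝ) + 3) ^ 2 - 1) * (μ * ν + 1)) * hμν
  rw [h1]
  have h2 : ((m : ℝ) + 1) ^ 2 ≤ (2 * m + 3) ^ 2 - 1 := by nlinarith
  calc ((m : ℝ) + 1) ^ 2 ≤ ((2 * (m : ℝ) + 3) ^ 2 - 1) * 1 := by linarith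
    _ ≤ _ := by
      refine mul_le_mul_of_nonneg_left ?_ ((sq_nonneg _).trans h2)
      have : 0 ≤ (2 * (m : ℝ) + 3) ^ 2 * μ ^ 4 := by positivity
      linarith

lemma abs_stableCoeff_le_one (hμν : μ * ν = 1) (m : ℕ) : |stableCoeff μ ν m| ≤ 1 := by
  induction m using Nat.strong_induction_on with
  | _ m ih =>
    cases m with
    | zero => simp [stableCoeff_zero]
    | succ m =>
      have hP := sq_le_linearSymbol hμν m
      have hP0 : 0 < linearSymbol μ ν (2 * m + 3) := lt_of_lt_of_le (by positivity) hP
      rw [stableCoeff_succ, abs_div, abs_neg, abs_of_pos hP0, div_le_one hP0]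
      refine le_trans ?_ hP
      have hin : ∀ p ∈ Finset.HasAntidiagonal.antidiagonal m, |stableCoeff μ ν p.1 *
          ∑ r ∈ Finset.HasAntidiagonal.antidiagonal p.2, stableCoeff μ ν r.1 * stableCoeff μ ν r.2| ≤ m + 1 := by
        intro p hp
        have hp' := Finset.HasAntidiagonal.mem_antidiagonal.1 hp
        have h1 : |∑ r ∈ Finset.HasAntidiagonal.antidiagonal p.2, stableCoeff μ ν r.1 * stableCoeff μ ν r.2| ≤
            p.2 + 1 := by
          refine (Finset.abs_sum_le_sum_abs _ _).trans ?_
          refine (Finset.sum_le_card_nsmul _ _ 1 fun r hr => ?_).trans ?_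
          · have hr' := Finset.HasAntidiagonal.mem_antidiagonal.1 hr
            rw [abs_mul]
            exact mul_le_one₀ (ih _ (by omega)) (abs_nonneg _) (ih _ (by omega))
          · simp
        have h2 : (p.2 : ℝ) ≤ m := by exact_mod_cast (by omega : p.2 ≤ m)
        rw [abs_mul]
        calc _ ≤ 1 * ((p.2 : ℝ) + 1) :=
              mul_le_mul (ih _ (by omega)) h1 (abs_nonneg _) zero_le_one
          _ ≤ _ := by linarith
      refine (Finset.abs_sum_le_sum_abs _ _).trans ((Finset.sum_le_card_nsmul _ _ _ hin).trans ?_)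
      simp only [Finset.Nat.card_antidiagonal, nsmul_eq_mul]
      push_cast
      exact (sq _).ge

variable (𝕜 : Type*) [RCLike 𝕜]

/-- The odd power series with real coefficients `c`. -/
def oddSeries (c : ℕ → ℝ) (w : 𝕜) : 𝕜 := ∑' m, (c m : 𝕜) * w ^ (2 * m + 1)

/-- Polynomial growth of a sequence. -/
def PolyGrowth (c : ℕ → ℝ) : Prop := ∃ C : ℝ, ∃ k : ℕ, ∀ m : ℕ, |c m| ≤ C * (2 * m + 1) ^ k

lemma PolyGrowth.mul_odd {c : ℕ → ℝ} (hc : PolyGrowth c) (t : ℝ) :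
    PolyGrowth fun m => -((2 * m + 1) * t) * c m := by
  obtain ⟨C, k, h⟩ := hc
  refine ⟨|t| * C, k + 1, fun m => ?_⟩
  have h0 : (0 : ℝ) ≤ 2 * m + 1 := by positivity
  rw [abs_mul, abs_neg, abs_mul, abs_of_nonneg h0, pow_succ]
  calc (2 * (m : ℝ) + 1) * |t| * |c m| ≤ (2 * (m : ℝ) + 1) * |t| * (C * (2 * m + 1) ^ k) := by
        gcongr; exact h m
    _ = _ := by ring

lemma summable_odd_pow_mul {r : ℝ} (h0 : 0 ≤ r) (h1 : r < 1) (C : ℝ) (k : ℕ) :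
    Summable fun m : ℕ => C * (2 * m + 1) ^ k * r ^ (2 * m) := by
  rcases h0.eq_or_lt with rfl | h0
  · refine summable_of_ne_finset_zero (s := {0}) fun m hm => ?_
    have : m ≠ 0 := by simpa using hm
    simp [this]
  have hs := summable_pow_mul_geometric_of_norm_lt_one k (r := r) (by
    rwa [Real.norm_eq_abs, abs_of_pos h0])
  have hinj : Function.Injective fun m : ℕ => 2 * m + 1 := fun a b h => by
    simp only at h; omega
  have := (hs.comp_injective hinj).mul_left (C / r)
  refine this.congr fun m => ?_
  simp only [Function.comp, Nat.cast_add, Nat.cast_mul, Nat.cast_ofNat, Nat.cast_one, pow_succ]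
  field_simp

variable {𝕜}

lemma norm_term_le {c : ℕ → ℝ} {C : ℝ} {k : ℕ} (h : ∀ m : ℕ, |c m| ≤ C * (2 * m + 1) ^ k) {w : 𝕜}
    (hw : ‖w‖ < 1) (m : ℕ) :
    ‖(c m : 𝕜) * w ^ (2 * m + 1)‖ ≤ C * (2 * m + 1) ^ k * ‖w‖ ^ (2 * m) := by
  rw [norm_mul, norm_pow, RCLike.norm_ofReal]
  have h1 : ‖w‖ ^ (2 * m + 1) ≤ ‖w‖ ^ (2 * m) :=
    pow_le_pow_of_le_one (norm_nonneg _) hw.le (by omega)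
  exact mul_le_mul (h m) h1 (by positivity) ((abs_nonneg _).trans (h m))

lemma PolyGrowth.summable {c : ℕ → ℝ} (hc : PolyGrowth c) {w : 𝕜} (hw : ‖w‖ < 1) :
    Summable fun m => (c m : 𝕜) * w ^ (2 * m + 1) := by
  obtain ⟨C, k, h⟩ := hc
  exact Summable.of_norm_bounded (summable_odd_pow_mul (norm_nonneg w) hw C k) (norm_term_le h hw)

lemma oddSeries_zero (c : ℕ → ℝ) : oddSeries 𝕜 c 0 = 0 := by simp [oddSeries]

lemma oddSeries_neg (c : ℕ → ℝ) (w : 𝕜) : oddSeries 𝕜 c (-w) = -oddSeries 𝕜 c w := by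
  unfold oddSeries
  rw [← tsum_neg]
  exact tsum_congr fun m => by rw [Odd.neg_pow ⟨m, rfl⟩]; ring

lemma oddSeries_ofReal (c : ℕ → ℝ) (w : ℝ) :
    oddSeries ℂ c (w : ℂ) = ((oddSeries ℝ c w : ℝ) : ℂ) := by
  unfold oddSeries
  rw [Complex.ofReal_tsum]
  exact tsum_congr fun m => by push_cast; rfl

lemma PolyGrowth.hasDerivAt {c : ℕ → ℝ} (hc : PolyGrowth c) {w : 𝕜} (hw : ‖w‖ < 1) :
    HasDerivAt (oddSeries 𝕜 c) (∑' m : ℕ, (c m : 𝕜) * ((2 * m + 1) * w ^ (2 * m))) w := by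
  have hc' := hc
  obtain ⟨C, k, h⟩ := hc
  obtain ⟨r, hr1, hr2⟩ := exists_between hw
  have hr0 : 0 ≤ r := (norm_nonneg w).trans hr1.le
  refine hasDerivAt_tsum_of_isPreconnected (t := Metric.ball (0 : 𝕜) r) (y₀ := 0)
    (g := fun m w => (c m : 𝕜) * w ^ (2 * m + 1))
    (g' := fun m w => (c m : 𝕜) * ((2 * m + 1) * w ^ (2 * m)))
    (summable_odd_pow_mul hr0 hr2 C (k + 1)) Metric.isOpen_ball
    (convex_ball (0 : 𝕜) r).isPreconnected (fun m y _ => ?_) (fun m y hy => ?_)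
    (Metric.mem_ball_self (by linarith [norm_nonneg w])) (hc'.summable (by simp)) (by simpa using hr1)
  · have := (hasDerivAt_pow (2 * m + 1) y).const_mul (c m : 𝕜)
    simpa using this
  · have hy : ‖y‖ ≤ r := by simpa using (mem_ball_zero_iff.1 hy).le
    have e : ‖(2 * m + 1 : 𝕜)‖ = 2 * m + 1 := by
      have : (2 * m + 1 : 𝕜) = ((2 * m + 1 : ℝ) : 𝕜) := by push_cast; rfl
      rw [this, RCLike.norm_ofReal, abs_of_nonneg (by positivity)]
    rw [norm_mul, norm_mul, norm_pow, RCLike.norm_ofReal, e, pow_succ]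
    calc |c m| * ((2 * m + 1) * ‖y‖ ^ (2 * m)) ≤ (C * (2 * m + 1) ^ k) * ((2 * m + 1) * r ^ (2 * m)) := by
          gcongr
          · exact (abs_nonneg _).trans (h m)
          · exact h m
      _ = _ := by ring

/-- Differentiating `oddSeries` along an exponential curve. -/
lemma PolyGrowth.hasDerivAt_exp {c : ℕ → ℝ} (hc : PolyGrowth c) {e : 𝕜 → 𝕜} {t : ℝ} {z : 𝕜}
    (he : HasDerivAt e (-(t : 𝕜) * e z) z) (hz : ‖e z‖ < 1) :
    HasDerivAt (fun z => oddSeries 𝕜 c (e z))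
      (oddSeries 𝕜 (fun m => -((2 * m + 1) * t) * c m) (e z)) z := by
  refine ((hc.hasDerivAt hz).comp z he).congr_deriv ?_
  unfold oddSeries
  rw [← tsum_mul_right]
  refine tsum_congr fun m => ?_
  push_cast
  ring

/-- The coefficients of the `k`-th derivative of the solution on the stable manifold. -/
def stableJetCoeff (μ ν : ℝ) : ℕ → ℕ → ℝ
  | 0 => stableCoeff μ ν
  | k + 1 => fun m => -((2 * m + 1) * μ) * stableJetCoeff μ ν k m

lemma polyGrowth_stableJetCoeff (hμν : μ * ν = 1) (k : ℕ) : PolyGrowth (stableJetCoeff μ ν k) := by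
  induction k with
  | zero => exact ⟨1, 0, fun m => by simpa [stableJetCoeff] using abs_stableCoeff_le_one hμν m⟩
  | succ k ih => exact ih.mul_odd μ

/-- The series satisfies the Swift–Hohenberg equation. -/
lemma oddSeries_stableJetCoeff_four (hμν : μ * ν = 1) {w : 𝕜} (hw : ‖w‖ < 1) :
    oddSeries 𝕜 (stableJetCoeff μ ν 4) w =
      -((ν ^ 2 - μ ^ 2 : ℝ) : 𝕜) * oddSeries 𝕜 (stableJetCoeff μ ν 2) w -
        oddSeries 𝕜 (stableJetCoeff μ ν 0) w ^ 3 + oddSeries 𝕜 (stableJetCoeff μ ν 0) w := by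
  set b : ℕ → 𝕜 := fun m => (stableCoeff μ ν m : 𝕜) * (w ^ 2) ^ m with hb
  have hbs : Summable fun m => ‖b m‖ := by
    refine Summable.of_norm_bounded (summable_odd_pow_mul (norm_nonneg w) hw 1 0) fun m => ?_
    rw [norm_norm, hb]
    simp only [norm_mul, norm_pow, RCLike.norm_ofReal, pow_zero, mul_one, one_mul, ← pow_mul]
    exact mul_le_of_le_one_left (by positivity) (abs_stableCoeff_le_one hμν m)
  have hF0 : oddSeries 𝕜 (stableJetCoeff μ ν 0) w = w * ∑' m, b m := by
    unfold oddSeries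
    rw [← tsum_mul_left]
    refine tsum_congr fun m => ?_
    simp only [hb, stableJetCoeff]
    ring
  have hcube : (∑' m, b m) ^ 3 = ∑' m, ∑ p ∈ Finset.HasAntidiagonal.antidiagonal m,
      b p.1 * ∑ r ∈ Finset.HasAntidiagonal.antidiagonal p.2, b r.1 * b r.2 := by
    rw [← tsum_mul_tsum_eq_tsum_sum_antidiagonal_of_summable_norm hbs
      (summable_norm_sum_mul_antidiagonal_of_summable_norm hbs hbs),
      ← tsum_mul_tsum_eq_tsum_sum_antidiagonal_of_summable_norm hbs hbs]
    ring
  have hcoef : ∀ m, ∑ p ∈ Finset.HasAntidiagonal.antidiagonal m,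
      b p.1 * ∑ r ∈ Finset.HasAntidiagonal.antidiagonal p.2, b r.1 * b r.2 =
      -((linearSymbol μ ν (2 * m + 3) * stableCoeff μ ν (m + 1) : ℝ) : 𝕜) * (w ^ 2) ^ m := by
    intro m
    have hP0 : linearSymbol μ ν (2 * m + 3) ≠ 0 :=
      (lt_of_lt_of_le (by positivity) (sq_le_linearSymbol hμν m)).ne'
    rw [stableCoeff_succ, mul_div_cancel₀ _ hP0]
    push_cast
    rw [neg_neg, Finset.sum_mul]
    refine Finset.sum_congr rfl fun p hp => ?_
    rw [Finset.mul_sum, Finset.mul_sum, Finset.sum_mul]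
    refine Finset.sum_congr rfl fun r hr => ?_
    simp only [hb]
    rw [← Finset.HasAntidiagonal.mem_antidiagonal.1 hp, ← Finset.HasAntidiagonal.mem_antidiagonal.1 hr,
      pow_add, pow_add]
    ring
  have hs4 := (polyGrowth_stableJetCoeff hμν 4).summable hw
  have hs2 := (polyGrowth_stableJetCoeff hμν 2).summable hw
  have hs0 := (polyGrowth_stableJetCoeff hμν 0).summable hw
  have hlin : oddSeries 𝕜 (stableJetCoeff μ ν 4) w +
      ((ν ^ 2 - μ ^ 2 : ℝ) : 𝕜) * oddSeries 𝕜 (stableJetCoeff μ ν 2) w -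
        oddSeries 𝕜 (stableJetCoeff μ ν 0) w =
      ∑' m : ℕ, ((linearSymbol μ ν (2 * m + 1) * stableCoeff μ ν m : ℝ) : 𝕜) * w ^ (2 * m + 1) := by
    unfold oddSeries
    rw [← tsum_mul_left, ← hs4.tsum_add (hs2.mul_left _),
      ← (hs4.add (hs2.mul_left _)).tsum_sub hs0]
    refine tsum_congr fun m => ?_
    have key : linearSymbol μ ν (2 * m + 1) * stableCoeff μ ν m = stableJetCoeff μ ν 4 m +
        (ν ^ 2 - μ ^ 2) * stableJetCoeff μ ν 2 m - stableJetCoeff μ ν 0 m := by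
      simp only [stableJetCoeff, linearSymbol]
      linear_combination (-(μ * ν + 1) * stableCoeff μ ν m) * hμν
    rw [key]
    push_cast
    ring
  have hsum : Summable fun m : ℕ =>
      ((linearSymbol μ ν (2 * m + 1) * stableCoeff μ ν m : ℝ) : 𝕜) * w ^ (2 * m + 1) := by
    refine ((hs4.add (hs2.mul_left ((ν ^ 2 - μ ^ 2 : ℝ) : 𝕜))).sub hs0).congr fun m => ?_
    have key : linearSymbol μ ν (2 * m + 1) * stableCoeff μ ν m = stableJetCoeff μ ν 4 m +
        (ν ^ 2 - μ ^ 2) * stableJetCoeff μ ν 2 m - stableJetCoeff μ ν 0 m := by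
      simp only [stableJetCoeff, linearSymbol]
      linear_combination (-(μ * ν + 1) * stableCoeff μ ν m) * hμν
    rw [key]
    push_cast
    ring
  have hfin : ∑' m : ℕ, ((linearSymbol μ ν (2 * m + 1) * stableCoeff μ ν m : ℝ) : 𝕜) * w ^ (2 * m + 1) =
      -(w * ∑' m, b m) ^ 3 := by
    rw [hsum.tsum_eq_zero_add, mul_pow, hcube, ← tsum_mul_left, ← tsum_neg]
    have h0 : linearSymbol μ ν (2 * (0 : ℕ) + 1) = 0 := by simp [linearSymbol]
    rw [h0, zero_mul, RCLike.ofReal_zero, zero_mul, zero_add]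
    refine tsum_congr fun m => ?_
    rw [hcoef m]
    have : (2 * ((m + 1 : ℕ) : ℝ) + 1) = 2 * m + 3 := by push_cast; ring
    rw [this]
    ring
  rw [hfin, ← hF0] at hlin
  linear_combination hlin

end StableSeries

section StableManifold

variable {a μ ν : ℝ} {u : ℕ → ℝ → ℝ}

lemma oddSeries_hasDerivAt_zero {𝕜 : Type*} [RCLike 𝕜] {c : ℕ → ℝ} (hc : PolyGrowth c) :
    HasDerivAt (oddSeries 𝕜 c) (c 0 : 𝕜) 0 := by
  refine (hc.hasDerivAt (w := (0 : 𝕜)) (by simp)).congr_deriv ?_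
  rw [tsum_eq_single 0 fun m hm => by simp [hm]]
  simp

lemma norm_oddSeries_stableCoeff_le {𝕜 : Type*} [RCLike 𝕜] (hμν : μ * ν = 1) {w : 𝕜}
    (hw : ‖w‖ ≤ 1 / 2) : ‖oddSeries 𝕜 (stableCoeff μ ν) w‖ ≤ 2 * ‖w‖ := by
  have h0 := norm_nonneg w
  have hg := (hasSum_geometric_of_lt_one (r := ‖w‖ ^ 2) (by positivity) (by nlinarith)).mul_left ‖w‖
  refine (tsum_of_norm_bounded hg fun m => ?_).trans ?_
  · rw [norm_mul, norm_pow, RCLike.norm_ofReal, pow_succ, pow_mul]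
    have := abs_stableCoeff_le_one hμν m
    calc _ ≤ 1 * ((‖w‖ ^ 2) ^ m * ‖w‖) := by gcongr
      _ = _ := by ring
  · rw [mul_comm 2]
    refine mul_le_mul_of_nonneg_left ?_ h0
    rw [inv_le_comm₀ (by nlinarith) two_pos]
    nlinarith

/-- The jet of the solution on the stable manifold with parameter `w`. -/
def stableJet (μ ν w : ℝ) (k : ℕ) (x : ℝ) : ℝ :=
  oddSeries ℝ (stableJetCoeff μ ν k) (w * Real.exp (-μ * x))

lemma isJetSolution_stableJet (hμ : 0 < μ) (hμν : μ * ν = 1) (ha : a = ν ^ 2 - μ ^ 2) {w : ℝ}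
    (hw : |w| < 1) : IsJetSolution a (Set.Ici 0) (stableJet μ ν w) := by
  have hlt : ∀ x ∈ Set.Ici (0 : ℝ), ‖w * Real.exp (-μ * x)‖ < 1 := by
    intro x hx
    rw [Real.norm_eq_abs, abs_mul, Real.abs_exp]
    have : Real.exp (-μ * x) ≤ 1 := Real.exp_le_one_iff.2 (by
      have : 0 ≤ μ * x := mul_nonneg hμ.le hx
      linarith)
    exact (mul_le_of_le_one_right (abs_nonneg _) this).trans_lt hw
  have hd : ∀ k, ∀ x ∈ Set.Ici (0 : ℝ),
      HasDerivAt (stableJet μ ν w k) (stableJet μ ν w (k + 1) x) x := by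
    intro k x hx
    refine (polyGrowth_stableJetCoeff hμν k).hasDerivAt_exp (t := μ)
      (e := fun x => w * Real.exp (-μ * x)) ?_ (hlt x hx)
    have := (((hasDerivAt_id x).const_mul (-μ)).exp).const_mul w
    refine this.congr_deriv ?_
    simp only [id, RCLike.ofReal_real_eq_id]
    ring
  refine ⟨hd 0, hd 1, hd 2, fun x hx => (hd 3 x hx).congr_deriv ?_⟩
  have := oddSeries_stableJetCoeff_four hμν (hlt x hx)
  simp only [RCLike.ofReal_real_eq_id, id] at this
  rw [ha]
  exact this

lemma tendsto_stableJet (hμ : 0 < μ) (hμν : μ * ν = 1) (w : ℝ) (k : ℕ) :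
    Tendsto (stableJet μ ν w k) atTop (𝓝 0) := by
  have h1 : Tendsto (fun x => w * Real.exp (-μ * x)) atTop (𝓝 0) := by
    have h2 : Tendsto (fun x : ℝ => -μ * x) atTop atBot :=
      tendsto_id.const_mul_atTop_of_neg (neg_lt_zero.2 hμ)
    simpa using (Real.tendsto_exp_atBot.comp h2).const_mul w
  have h2 := (oddSeries_hasDerivAt_zero (𝕜 := ℝ) (polyGrowth_stableJetCoeff hμν k)).continuousAt
  have h3 := h2.tendsto.comp h1
  rw [oddSeries_zero] at h3
  exact h3

/-- Every solution tending to `0` lies on the analytic stable manifold. -/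
lemma IsJetSolution.exists_eq_oddSeries (hu : IsJetSolution a Set.univ u) (hμ : 0 < μ) (hν : 0 < ν)
    (hμν : μ * ν = 1) (ha : a = ν ^ 2 - μ ^ 2) (h0 : Tendsto (u 0) atTop (𝓝 0)) :
    ∃ x₁ w : ℝ, |w| < 1 / 2 ∧ ∀ x ≥ x₁,
      u 0 x = oddSeries ℝ (stableCoeff μ ν) (w * Real.exp (-μ * (x - x₁))) := by
  set X : ℝ → ℝ := fun w => stableMode μ ν (stableJet μ ν w) 0 with hX
  have hXeq : X = fun w => oddSeries ℝ (stableJetCoeff μ ν 3) w +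
      ν ^ 2 * oddSeries ℝ (stableJetCoeff μ ν 1) w -
        μ * (oddSeries ℝ (stableJetCoeff μ ν 2) w +
          ν ^ 2 * oddSeries ℝ (stableJetCoeff μ ν 0) w) := by
    funext w
    simp [hX, stableMode, stableJet]
  have hXneg : ∀ w, X (-w) = -X w := by
    intro w
    rw [hXeq]
    simp only [oddSeries_neg]
    ring
  have hXcont : ∀ w : ℝ, |w| < 1 → ContinuousAt X w := by
    intro w hw
    have h := fun k => ((polyGrowth_stableJetCoeff hμν k).hasDerivAt (w := w) hw).continuousAt
    rw [hXeq]
    exact ((h 3).add ((h 1).const_mul _)).sub (((h 2).add ((h 0).const_mul _)).const_mul _)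
  have hXd : HasDerivAt X (-2 * μ * (μ ^ 2 + ν ^ 2)) 0 := by
    have h := fun k => oddSeries_hasDerivAt_zero (𝕜 := ℝ) (polyGrowth_stableJetCoeff hμν k)
    rw [hXeq]
    refine (((h 3).add ((h 1).const_mul _)).sub
      (((h 2).add ((h 0).const_mul _)).const_mul _)).congr_deriv ?_
    simp [stableJetCoeff, stableCoeff_zero]
    ring
  have hne : ∀ᶠ w in 𝓝[≠] (0 : ℝ), X w ≠ 0 := hXd.eventually_ne (by
    have : 0 < μ * (μ ^ 2 + ν ^ 2) := by positivity
    linarith [this])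
  have hsmall : ∀ᶠ w in 𝓝[≠] (0 : ℝ), 60 * w ^ 2 < μ ∧ |w| < 1 / 2 := by
    refine (Filter.Eventually.and ?_ ?_).filter_mono nhdsWithin_le_nhds
    · have : ContinuousAt (fun w : ℝ => 60 * w ^ 2) 0 := by fun_prop
      exact this.eventually_lt continuousAt_const (by simpa using hμ)
    · exact continuousAt_id.abs.eventually_lt continuousAt_const (by simp)
  obtain ⟨w₁, hw₁, hw₂, hw₃⟩ := (hne.and hsmall).exists
  obtain ⟨hS, hU, hC, hC'⟩ := hu.tendsto_modes hμ hν hμν ha h0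
  obtain ⟨x₀, hx₀⟩ := hu.exists_decay hμ hν hμν ha h0
  have e1 : ∀ᶠ x in atTop, |stableMode μ ν u x| < |X w₁| := by
    have := hS.abs
    rw [abs_zero] at this
    exact this.eventually_lt_const (abs_pos.2 hw₁)
  have e2 : ∀ᶠ x in atTop, 30 * stableMode μ ν u x ^ 2 < μ := by
    have := (hS.pow 2).const_mul 30
    norm_num at this
    exact this.eventually_lt_const hμ
  obtain ⟨x₁, hx1, hx2, hx3⟩ := (e1.and (e2.and (eventually_ge_atTop x₀))).exists
  obtain ⟨w, hw, hXw⟩ : stableMode μ ν u x₁ ∈ Set.image X (Set.uIcc (-w₁) w₁) := by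
    refine intermediate_value_uIcc (fun w hw => ?_) ?_
    · refine (hXcont w ?_).continuousWithinAt
      rw [← abs_neg] at hw₃
      rcases abs_lt.1 hw₃ with ⟨h1, h2⟩
      rcases Set.mem_uIcc.1 hw with h | h <;> exact abs_lt.2 ⟨by linarith, by linarith⟩
    · rw [hXneg]
      rcases abs_lt.1 hx1 with ⟨h1, h2⟩
      rcases abs_cases (X w₁) with ⟨h, -⟩ | ⟨h, -⟩ <;> rw [h] at h1 h2 <;>
        refine Set.mem_uIcc.2 ?_
      · exact Or.inl ⟨h1.le, h2.le⟩
      · exact Or.inr ⟨by linarith, by linarith⟩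
  have hwle : |w| ≤ |w₁| := by
    rcases Set.mem_uIcc.1 hw with h | h
    · exact abs_le_abs h.2 (by linarith)
    · rw [← abs_neg w₁]
      exact abs_le_abs h.2 (by linarith)
  have hwlt : |w| < 1 / 2 := hwle.trans_lt hw₃
  have hsq : w ^ 2 ≤ w₁ ^ 2 := sq_le_sq.2 hwle
  refine ⟨x₁, w, hwlt, fun x hx => ?_⟩
  set v : ℕ → ℝ → ℝ := fun k x => u k (x + x₁) with hv
  have hvj : IsJetSolution a (Set.Ici 0) v :=
    ⟨fun x _ => (hu.hasDerivAt_zero _ trivial).comp_add_const x x₁,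
      fun x _ => (hu.hasDerivAt_one _ trivial).comp_add_const x x₁,
      fun x _ => (hu.hasDerivAt_two _ trivial).comp_add_const x x₁,
      fun x _ => (hu.hasDerivAt_three _ trivial).comp_add_const x x₁⟩
  have htr : Tendsto (fun x : ℝ => x + x₁) atTop atTop := tendsto_atTop_add_const_right _ _ tendsto_id
  have t := tendsto_stableJet hμ hμν w
  have key := hvj.eqOn_of_stableMode_eq (isJetSolution_stableJet hμ hμν ha (by linarith)) hμ hν hμν ha
    (η := 3 * stableMode μ ν u x₁ ^ 2 + 6 * w ^ 2) (by linarith) ?_ ?_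
    (hS.comp htr) ?_ (hU.comp htr) ?_ (hC.comp htr) ?_ (hC'.comp htr) ?_ (x - x₁) (by linarith)
  · simpa [hv, stableJet, stableJetCoeff] using key
  · intro x hx
    set E := Real.exp (-μ * x) with hE
    have hE0 : 0 < E := Real.exp_pos _
    have hE1 : E ≤ 1 := Real.exp_le_one_iff.2 (by nlinarith)
    have b1 : v 0 x ^ 2 ≤ 2 * stableMode μ ν u x₁ ^ 2 * E := by
      have := hx₀ x₁ hx3 (x + x₁) (by linarith)
      rwa [add_sub_cancel_right] at this
    have b2 : stableJet μ ν w 0 x ^ 2 ≤ 4 * w ^ 2 * E := by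
      have hle : |w * E| ≤ |w| := by
        rw [abs_mul, abs_of_pos hE0]
        exact mul_le_of_le_one_right (abs_nonneg _) hE1
      have h := norm_oddSeries_stableCoeff_le hμν (w := w * E) (by
        rw [Real.norm_eq_abs]; linarith)
      simp only [Real.norm_eq_abs] at h
      have h' := pow_le_pow_left₀ (abs_nonneg _) h 2
      rw [sq_abs, mul_pow, sq_abs] at h'
      refine h'.trans ?_
      have : w ^ 2 * (E * E) ≤ w ^ 2 * (1 * E) := by gcongr
      linarith
    have := sq_nonneg (v 0 x - stableJet μ ν w 0 x)
    linarith
  · refine Eq.trans ?_ hXw.symm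
    simp [hv, stableMode]
  · have h := ((t 3).add ((t 1).const_mul (ν ^ 2))).sub
      (((t 2).add ((t 0).const_mul (ν ^ 2))).const_mul μ)
    simp only [mul_zero, add_zero, sub_zero] at h
    exact h
  · have h := ((t 3).add ((t 1).const_mul (ν ^ 2))).add
      (((t 2).add ((t 0).const_mul (ν ^ 2))).const_mul μ)
    simp only [mul_zero, add_zero] at h
    exact h
  · have h := (t 2).sub ((t 0).const_mul (μ ^ 2))
    simp only [mul_zero, sub_zero] at h
    exact h
  · have h := (t 3).sub ((t 1).const_mul (μ ^ 2))
    simp only [mul_zero, sub_zero] at h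
    exact h

end StableManifold

section Meromorphic

variable {U f g : ℂ → ℂ}

lemma IsPoleAt.not_isBoundedUnder {p : ℂ} (h : IsPoleAt U p) {C : ℝ}
    (hC : ∀ᶠ z in 𝓝[≠] p, ‖U z‖ ≤ C) : False := by
  obtain ⟨z, h1, h2⟩ := ((h.eventually_gt_atTop C).and hC).exists
  exact absurd h1 (not_lt.2 h2)

lemma AnalyticAt.not_isPoleAt {p : ℂ} (h : AnalyticAt ℂ U p) : ¬ IsPoleAt U p := by
  intro hp
  refine hp.not_isBoundedUnder (C := ‖U p‖ + 1) ?_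
  have := h.continuousAt.norm.eventually_lt (continuousAt_const (y := ‖U p‖ + 1)) (by simp)
  exact (this.filter_mono nhdsWithin_le_nhds).mono fun _ => le_of_lt

lemma countable_setOf_isPoleAt (U : ℂ → ℂ) : {p | IsPoleAt U p}.Countable := by
  have hcov : {p | IsPoleAt U p} ⊆ ⋃ n : ℕ, {p | IsPoleAt U p ∧ ‖U p‖ ≤ n} := by
    intro p hp
    obtain ⟨n, hn⟩ := exists_nat_ge ‖U p‖
    exact Set.mem_iUnion.2 ⟨n, hp, hn⟩
  refine (Set.countable_iUnion fun n => ?_).mono hcov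
  refine (HereditarilyLindelofSpace.isLindelof _).countable_of_isDiscrete
    (isDiscrete_iff_discreteTopology.2 (discreteTopology_subtype_iff.2 fun p hp => ?_))
  rw [← Filter.empty_mem_iff_bot, Filter.mem_inf_principal]
  filter_upwards [hp.1.eventually_gt_atTop (n : ℝ)] with z hz hz'
  exact absurd hz (not_lt.2 hz'.2)

lemma MeromorphicOnPlane.meromorphicAt (hU : MeromorphicOnPlane U) (p : ℂ) :
    MeromorphicAt U p := by
  rcases hU p with h | hp
  · exact h.meromorphicAt
  classical
  set P := {q | IsPoleAt U q} with hP
  have hPc : P.Countable := countable_setOf_isPoleAt U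
  set G : ℂ → ℂ := fun z => if IsPoleAt U z then 0 else (U z)⁻¹ with hG
  obtain ⟨r, hr0, hr⟩ := Metric.eventually_nhds_iff_ball.1
    (eventually_nhdsWithin_iff.1 (hp.eventually_gt_atTop 1))
  have hne : ∀ z ∈ Metric.ball p r, z ∉ P → U z ≠ 0 := by
    intro z hz hzP h0
    have := hr z hz (fun h => hzP (by rw [Set.mem_singleton_iff.1 h]; exact hp))
    rw [h0, norm_zero] at this
    linarith
  have hGan : ∀ z ∈ Metric.ball p r, z ∉ P → AnalyticAt ℂ G z := by
    intro z hz hzP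
    have hz' := (hU z).resolve_right hzP
    refine (hz'.inv (hne z hz hzP)).congr ?_
    filter_upwards [hz'.eventually_analyticAt] with y hy
    simp [hG, hy.not_isPoleAt]
  have hGcont : ∀ z ∈ Metric.ball p r, ContinuousAt G z := by
    intro z hz
    by_cases hzP : z ∈ P
    · have hGz : G z = 0 := if_pos hzP
      rw [← continuousWithinAt_compl_self, ContinuousWithinAt, hGz, tendsto_zero_iff_norm_tendsto_zero]
      refine squeeze_zero (fun _ => norm_nonneg _) (fun y => ?_) (tendsto_inv_atTop_zero.comp hzP)
      simp only [hG, Function.comp]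
      split_ifs <;> simp
    · exact (hGan z hz hzP).continuousAt
  have hGp : AnalyticAt ℂ G p := by
    have hsub : Metric.closedBall p (r / 2) ⊆ Metric.ball p r :=
      Metric.closedBall_subset_ball (by linarith)
    refine (Complex.hasFPowerSeriesOnBall_of_differentiable_off_countable (R := ⟨r / 2, by linarith⟩)
      (c := p) (f := G) hPc (fun z hz => (hGcont z (hsub hz)).continuousWithinAt) (fun z hz => ?_)
      (NNReal.coe_pos.1 (half_pos hr0))).analyticAt
    exact (hGan z (hsub (Metric.ball_subset_closedBall hz.1)) hz.2).differentiableAt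
  rcases hGp.eventually_eq_zero_or_eventually_ne_zero with h | h
  · exfalso
    have hd := hPc.dense_compl ℂ
    obtain ⟨z, hz, hzP⟩ := mem_closure_iff_frequently.1 (hd p) |>.and_eventually
      (h.and (Metric.ball_mem_nhds p hr0)) |>.exists
    have : G z = (U z)⁻¹ := if_neg hz
    exact inv_ne_zero (hne z hzP.2 hz) (this ▸ hzP.1)
  · refine hGp.meromorphicAt.inv.congr ?_
    filter_upwards [h] with z hz
    have hz' : ¬ IsPoleAt U z := fun h' => hz (if_pos h')
    simp [hG, hz']

lemma AnalyticAt.eq_of_eventuallyEq_punctured {z : ℂ} (hf : AnalyticAt ℂ f z)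
    (hg : AnalyticAt ℂ g z) (h : f =ᶠ[𝓝[≠] z] g) : f =ᶠ[𝓝 z] g :=
  (hf.frequently_eq_iff_eventually_eq hg).1 h.frequently

lemma MeromorphicOnPlane.analyticAt_of_eventuallyEq (hU : MeromorphicOnPlane U) {z : ℂ}
    (hg : AnalyticAt ℂ g z) (h : U =ᶠ[𝓝[≠] z] g) : AnalyticAt ℂ U z := by
  refine (hU z).resolve_right fun hp => hp.not_isBoundedUnder (C := ‖g z‖ + 1) ?_
  have := hg.continuousAt.norm.eventually_lt (continuousAt_const (y := ‖g z‖ + 1)) (by simp)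
  filter_upwards [this.filter_mono nhdsWithin_le_nhds, h] with y h1 h2
  rw [h2]
  exact h1.le

end Meromorphic

section RealAxis

variable {a μ ν : ℝ} {U f g : ℂ → ℂ}

/-- The identity theorem for meromorphic functions on a connected set. -/
lemma meromorphic_identity_on {S : Set ℂ} (hS : IsConnected S) (hf : ∀ z ∈ S, MeromorphicAt f z)
    (hg : ∀ z ∈ S, MeromorphicAt g z) {z₀ z : ℂ} (hz₀ : z₀ ∈ S) (hz : z ∈ S)
    (h : f =ᶠ[𝓝[≠] z₀] g) : f =ᶠ[𝓝[≠] z] g := by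
  have hm : MeromorphicOn (f - g) S := fun z hz => (hf z hz).sub (hg z hz)
  have h0 : meromorphicOrderAt (f - g) z₀ = ⊤ :=
    meromorphicOrderAt_eq_top_iff.2 (h.mono fun y hy => by simp [hy])
  have key : meromorphicOrderAt (f - g) z = ⊤ := by
    by_contra hz'
    exact (hm.exists_meromorphicOrderAt_ne_top_iff_forall hS).1
      ⟨⟨z, hz⟩, hz'⟩ ⟨z₀, hz₀⟩ h0
  exact (meromorphicOrderAt_eq_top_iff.1 key).mono fun y hy => sub_eq_zero.1 hy

/-- The identity theorem for meromorphic functions on the plane. -/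
lemma meromorphic_identity (hf : ∀ z, MeromorphicAt f z) (hg : ∀ z, MeromorphicAt g z) {z₀ : ℂ}
    (h : f =ᶠ[𝓝[≠] z₀] g) (z : ℂ) : f =ᶠ[𝓝[≠] z] g :=
  meromorphic_identity_on isConnected_univ (fun z _ => hf z) (fun z _ => hg z) trivial trivial h

/-- Analytic functions agreeing on the real axis near a real point agree near it. -/
lemma AnalyticAt.eventuallyEq_of_real {x : ℝ} (hf : AnalyticAt ℂ f x) (hg : AnalyticAt ℂ g x)
    (h : ∀ᶠ y : ℝ in 𝓝 x, f y = g y) : f =ᶠ[𝓝 (x : ℂ)] g := by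
  refine (hf.frequently_eq_iff_eventually_eq hg).1 ?_
  have ht : Tendsto (fun y : ℝ => (y : ℂ)) (𝓝[≠] x) (𝓝[≠] (x : ℂ)) :=
    tendsto_nhdsWithin_iff.2 ⟨(continuous_ofReal.tendsto x).mono_left nhdsWithin_le_nhds,
      eventually_nhdsWithin_of_forall fun y hy => by simpa using hy⟩
  exact ht.frequently (h.filter_mono nhdsWithin_le_nhds).frequently

lemma AnalyticAt.iteratedDeriv {z : ℂ} (hf : AnalyticAt ℂ f z) (n : ℕ) :
    AnalyticAt ℂ (_root_.iteratedDeriv n f) z := by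
  rw [iteratedDeriv_eq_iterate]
  exact hf.iterated_deriv n

lemma im_iteratedDeriv_eq_zero (hU : ∀ x : ℝ, AnalyticAt ℂ U x) (hreal : ∀ x : ℝ, (U x).im = 0)
    (n : ℕ) (x : ℝ) : (iteratedDeriv n U x).im = 0 := by
  induction n generalizing x with
  | zero => simpa using hreal x
  | succ n ih =>
    have h1 := ((hU x).iteratedDeriv n).differentiableAt.hasDerivAt.const_mul (-I)
    have h2 := h1.real_of_complex
    have h3 : (fun x : ℝ => (-I * iteratedDeriv n U x).re) = fun _ => 0 := by
      funext x
      simp [ih x]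
    rw [h3] at h2
    have := h2.unique (hasDerivAt_const x (0 : ℝ))
    rw [iteratedDeriv_succ]
    simpa using this

/-- The jet of `U` along the real axis. -/
def realJet (U : ℂ → ℂ) (k : ℕ) (x : ℝ) : ℝ := (iteratedDeriv k U x).re

lemma ofReal_realJet (hU : ∀ x : ℝ, AnalyticAt ℂ U x) (hreal : ∀ x : ℝ, (U x).im = 0)
    (n : ℕ) (x : ℝ) : ((realJet U n x : ℝ) : ℂ) = iteratedDeriv n U x :=
  Complex.ext rfl (by simp [im_iteratedDeriv_eq_zero hU hreal])

lemma isJetSolution_realJet (hU : ∀ x : ℝ, AnalyticAt ℂ U x) (hreal : ∀ x : ℝ, (U x).im = 0)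
    (hsol : ∀ z : ℂ, AnalyticAt ℂ U z → SatisfiesSH (a : ℂ) U z) :
    IsJetSolution a Set.univ (realJet U) := by
  have hd : ∀ n : ℕ, ∀ x ∈ Set.univ, HasDerivAt (realJet U n) (realJet U (n + 1) x) x := by
    intro n x _
    have := ((hU x).iteratedDeriv n).differentiableAt.hasDerivAt.real_of_complex
    rwa [← iteratedDeriv_succ] at this
  refine ⟨hd 0, hd 1, hd 2, fun x hx => (hd 3 x hx).congr_deriv ?_⟩
  have h := hsol x (hU x)
  unfold SatisfiesSH at h
  rw [← iteratedDeriv_zero (f := U)] at h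
  simp only [iteratedDeriv_zero] at h
  have h0 := ofReal_realJet hU hreal 0 x
  rw [iteratedDeriv_zero] at h0
  rw [← ofReal_realJet hU hreal 4, ← ofReal_realJet hU hreal 2, ← h0] at h
  norm_cast at h
  linarith

/-- The energy of the stationary Swift–Hohenberg equation. -/
def shEnergy (a : ℂ) (U : ℂ → ℂ) (z : ℂ) : ℂ :=
  iteratedDeriv 1 U z * iteratedDeriv 3 U z - iteratedDeriv 2 U z ^ 2 / 2 +
    a * iteratedDeriv 1 U z ^ 2 / 2 + U z ^ 4 / 4 - U z ^ 2 / 2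

lemma shEnergy_ofReal (hU : ∀ x : ℝ, AnalyticAt ℂ U x) (hreal : ∀ x : ℝ, (U x).im = 0) (x : ℝ) :
    shEnergy a U x = ((jetEnergy a (realJet U) x : ℝ) : ℂ) := by
  have h0 := ofReal_realJet hU hreal 0 x
  rw [iteratedDeriv_zero] at h0
  unfold shEnergy jetEnergy
  push_cast
  rw [h0, ofReal_realJet hU hreal, ofReal_realJet hU hreal, ofReal_realJet hU hreal]

lemma MeromorphicAt.iteratedDeriv {z : ℂ} (h : MeromorphicAt U z) (n : ℕ) :
    MeromorphicAt (_root_.iteratedDeriv n U) z := by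
  induction n with
  | zero => simpa using h
  | succ n ih =>
    rw [iteratedDeriv_succ]
    exact ih.deriv

/-- The energy vanishes identically once it vanishes on the real axis. -/
lemma eventually_shEnergy_eq_zero (hm : ∀ z, MeromorphicAt U z) (hU : ∀ x : ℝ, AnalyticAt ℂ U x)
    (h : ∀ x : ℝ, shEnergy a U x = 0) (z : ℂ) : ∀ᶠ y in 𝓝[≠] z, shEnergy a U y = 0 := by
  have hE : ∀ z, MeromorphicAt (shEnergy a U) z := by
    intro z
    have d := fun n => (hm z).iteratedDeriv n
    have c : ∀ c : ℂ, MeromorphicAt (fun _ => c) z := fun c => MeromorphicAt.const c z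
    exact (((((d 1).mul (d 3)).sub (((d 2).pow 2).div (c 2))).add
      (((c a).mul ((d 1).pow 2)).div (c 2))).add (((hm z).pow 4).div (c 4))).sub
        (((hm z).pow 2).div (c 2))
  have hE0 : AnalyticAt ℂ (shEnergy a U) ((0 : ℝ) : ℂ) := by
    have d := fun n => (hU 0).iteratedDeriv n
    have c : ∀ c : ℂ, AnalyticAt ℂ (fun _ => c) ((0 : ℝ) : ℂ) := fun c => analyticAt_const
    exact (((((d 1).mul (d 3)).sub (((d 2).pow 2).div (c 2) two_ne_zero)).add
      (((c a).mul ((d 1).pow 2)).div (c 2) two_ne_zero)).add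
        (((hU 0).pow 4).div (c 4) (by norm_num))).sub (((hU 0).pow 2).div (c 2) two_ne_zero)
  exact meromorphic_identity hE (fun z => MeromorphicAt.const 0 z) (z₀ := ((0 : ℝ) : ℂ))
    ((hE0.eventuallyEq_of_real analyticAt_const (.of_forall h)).filter_mono nhdsWithin_le_nhds) z

end RealAxis

section HalfPlane

variable {a μ ν : ℝ} {U f g : ℂ → ℂ}

lemma PolyGrowth.analyticAt {c : ℕ → ℝ} (hc : PolyGrowth c) {w : ℂ} (hw : ‖w‖ < 1) :
    AnalyticAt ℂ (oddSeries ℂ c) w := by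
  refine DifferentiableOn.analyticAt (s := Metric.ball 0 1) (fun z hz => ?_)
    (Metric.isOpen_ball.mem_nhds (by simpa using hw))
  exact (hc.hasDerivAt (by simpa using hz)).differentiableAt.differentiableWithinAt

lemma polyGrowth_stableCoeff (hμν : μ * ν = 1) : PolyGrowth (stableCoeff μ ν) :=
  polyGrowth_stableJetCoeff hμν 0

/-- On the half-plane `Re Z > x₁`, `U` is given by the stable manifold series with
parameter `c`. -/
def IsStableRep (μ ν : ℝ) (U : ℂ → ℂ) (c : ℂ) (x₁ : ℝ) : Prop :=
  ∀ Z : ℂ, x₁ < Z.re → ‖c * cexp (-μ * Z)‖ ≤ 1 / 2 ∧ AnalyticAt ℂ U Z ∧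
    U Z = oddSeries ℂ (stableCoeff μ ν) (c * cexp (-μ * Z))

lemma norm_cexp_neg_mul (μ : ℝ) (Z : ℂ) : ‖cexp (-μ * Z)‖ = Real.exp (-μ * Z.re) := by
  rw [Complex.norm_exp]
  simp

lemma exists_isStableRep (hmer : MeromorphicOnPlane U) (hU : ∀ x : ℝ, AnalyticAt ℂ U x)
    (hreal : ∀ x : ℝ, (U x).im = 0) (hsol : ∀ z : ℂ, AnalyticAt ℂ U z → SatisfiesSH (a : ℂ) U z)
    (htop : Tendsto (fun x : ℝ => U x) atTop (𝓝 0))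
    (hμ : 0 < μ) (hν : 0 < ν) (hμν : μ * ν = 1) (ha : a = ν ^ 2 - μ ^ 2) :
    ∃ c x₁, IsStableRep μ ν U c x₁ := by
  have hJ := isJetSolution_realJet hU hreal hsol
  have h0 : Tendsto (realJet U 0) atTop (𝓝 0) := by
    have := (continuous_re.tendsto 0).comp htop
    rw [zero_re] at this
    exact this.congr fun x => by simp [realJet]
  obtain ⟨x₁, w, hw, hx⟩ := hJ.exists_eq_oddSeries hμ hν hμν ha h0
  set c : ℂ := ((w * Real.exp (μ * x₁) : ℝ) : ℂ) with hc
  have hnorm : ∀ Z : ℂ, x₁ < Z.re → ‖c * cexp (-μ * Z)‖ ≤ 1 / 2 := by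
    intro Z hZ
    rw [norm_mul, norm_cexp_neg_mul, hc, Complex.norm_real, Real.norm_eq_abs, abs_mul, Real.abs_exp,
      mul_assoc, ← Real.exp_add]
    refine (mul_le_of_le_one_right (abs_nonneg _) (Real.exp_le_one_iff.2 ?_)).trans hw.le
    nlinarith
  have hfan : ∀ Z : ℂ, x₁ < Z.re →
      AnalyticAt ℂ (fun Z => oddSeries ℂ (stableCoeff μ ν) (c * cexp (-μ * Z))) Z := by
    intro Z hZ
    have h1 : AnalyticAt ℂ (fun Z : ℂ => c * cexp (-μ * Z)) Z := by fun_prop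
    exact AnalyticAt.comp_of_eq ((polyGrowth_stableCoeff hμν).analyticAt (w := c * cexp (-μ * Z))
      (by linarith [hnorm Z hZ])) h1 rfl
  refine ⟨c, x₁, fun Z hZ => ⟨hnorm Z hZ, ?_⟩⟩
  have hreq : ∀ x : ℝ, x₁ < x → U x = oddSeries ℂ (stableCoeff μ ν) (c * cexp (-μ * x)) := by
    intro x hx'
    have h1 := ofReal_realJet hU hreal 0 x
    rw [iteratedDeriv_zero] at h1
    rw [← h1, hx x hx'.le, ← oddSeries_ofReal, hc]
    congr 1
    push_cast
    rw [mul_assoc, ← Complex.exp_add]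
    congr 2
    ring
  have hpt : x₁ < (((x₁ + 1 : ℝ) : ℂ)).re := by simp
  have hconn : IsConnected {Z : ℂ | x₁ < Z.re} :=
    (convex_halfSpace_re_gt x₁).isConnected ⟨_, hpt⟩
  have hloc : U =ᶠ[𝓝 ((x₁ + 1 : ℝ) : ℂ)]
      fun Z => oddSeries ℂ (stableCoeff μ ν) (c * cexp (-μ * Z)) :=
    (hU _).eventuallyEq_of_real (hfan _ hpt)
      ((lt_mem_nhds (by linarith : x₁ < x₁ + 1)).mono hreq)
  have hZ' := meromorphic_identity_on hconn (fun z _ => hmer.meromorphicAt z)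
    (fun z hz => (hfan z hz).meromorphicAt) hpt (z := Z) hZ (hloc.filter_mono nhdsWithin_le_nhds)
  have hUZ := hmer.analyticAt_of_eventuallyEq (hfan Z hZ) hZ'
  exact ⟨hUZ, (hUZ.eq_of_eventuallyEq_punctured (hfan Z hZ) hZ').self_of_nhds⟩

end HalfPlane

section Translation

variable {μ ν x₁ : ℝ} {U : ℂ → ℂ} {c T σ : ℂ}

lemma MeromorphicAt.comp_add_const {z : ℂ} (h : MeromorphicAt U (z + T)) :
    MeromorphicAt (fun Z => U (Z + T)) z :=
  MeromorphicAt.comp_analyticAt (g := fun Z => Z + T) h (by fun_prop)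

lemma AnalyticAt.comp_add_const {z : ℂ} (h : AnalyticAt ℂ U (z + T)) :
    AnalyticAt ℂ (fun Z => U (Z + T)) z :=
  AnalyticAt.comp_of_eq (f := fun Z => Z + T) h (by fun_prop) rfl

lemma IsStableRep.norm_le_one (h : IsStableRep μ ν U c x₁) (hμν : μ * ν = 1) {Z : ℂ}
    (hZ : x₁ < Z.re) : ‖U Z‖ ≤ 1 := by
  obtain ⟨h1, -, h2⟩ := h Z hZ
  rw [h2]
  linarith [norm_oddSeries_stableCoeff_le hμν h1]

/-- Translations by the (anti)periods of the exponential are (anti)periods of `U`. -/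
lemma IsStableRep.eventually_add (h : IsStableRep μ ν U c x₁) (hm : ∀ z, MeromorphicAt U z)
    (hμ : 0 < μ) (hσ : σ = 1 ∨ σ = -1) (hT : cexp (-μ * T) = σ) (z : ℂ) :
    (fun Z => U (Z + T)) =ᶠ[𝓝[≠] z] fun Z => σ * U Z := by
  have hTre : T.re = 0 := by
    have h1 := norm_cexp_neg_mul μ T
    rw [hT, show ‖σ‖ = 1 by rcases hσ with rfl | rfl <;> simp, eq_comm, Real.exp_eq_one_iff] at h1
    exact (mul_eq_zero.1 h1).resolve_left (neg_ne_zero.2 hμ.ne')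
  refine meromorphic_identity (fun z => (hm _).comp_add_const)
    (fun z => (MeromorphicAt.const σ z).mul (hm z)) (z₀ := ((x₁ + 1 : ℝ) : ℂ)) ?_ z
  have hopen : ∀ᶠ Z in 𝓝 ((x₁ + 1 : ℝ) : ℂ), x₁ < Z.re :=
    (isOpen_lt continuous_const continuous_re).mem_nhds (by simp)
  filter_upwards [hopen.filter_mono nhdsWithin_le_nhds] with Z hZ
  simp only [Pi.mul_apply]
  rw [(h Z hZ).2.2, (h (Z + T) (by simpa [hTre] using hZ)).2.2, mul_add, Complex.exp_add, hT]
  rcases hσ with rfl | rfl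
  · simp
  · rw [mul_neg_one, mul_neg, oddSeries_neg, neg_one_mul]

/-- Every (anti)period of `U` is an (anti)period of the exponential. -/
lemma IsStableRep.cexp_eq (h : IsStableRep μ ν U c x₁) (hμ : 0 < μ) (hμν : μ * ν = 1)
    (hc : c ≠ 0) (hT : ∀ z, (fun Z => U (Z + T)) =ᶠ[𝓝[≠] z] fun Z => σ * U Z) :
    cexp (-μ * T) = σ := by
  by_contra hne
  set F := oddSeries ℂ (stableCoeff μ ν) with hF
  have hF0 : HasDerivAt F 1 0 := by
    have := oddSeries_hasDerivAt_zero (𝕜 := ℂ) (polyGrowth_stableCoeff hμν)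
    simpa [stableCoeff_zero] using this
  have hd : HasDerivAt (fun w => F (w * cexp (-μ * T)) - σ * F w) (cexp (-μ * T) - σ) 0 := by
    have h1 : HasDerivAt (fun w : ℂ => w * cexp (-μ * T)) (cexp (-μ * T)) 0 := by
      simpa using (hasDerivAt_id (0 : ℂ)).mul_const (cexp (-μ * T))
    have h2 := (HasDerivAt.comp_of_eq (h₂ := F) (0 : ℂ) hF0 h1 (by simp)).sub (hF0.const_mul σ)
    rw [mul_one, one_mul] at h2
    exact h2
  have hev := hd.eventually_ne (c := 0) (sub_ne_zero.2 hne)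
  have ht : Tendsto (fun x : ℝ => c * cexp (-μ * x)) atTop (𝓝[≠] 0) := by
    refine tendsto_nhdsWithin_iff.2 ⟨?_, .of_forall fun x => mul_ne_zero hc (Complex.exp_ne_zero _)⟩
    have h2 : Tendsto (fun x : ℝ => -μ * x) atTop atBot :=
      tendsto_id.const_mul_atTop_of_neg (neg_lt_zero.2 hμ)
    have h3 := (continuous_ofReal.tendsto 0).comp (Real.tendsto_exp_atBot.comp h2)
    have h4 := h3.const_mul c
    simpa [Function.comp_def] using h4
  obtain ⟨x, hx, h1, h2⟩ := ((ht.eventually hev).and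
    ((eventually_gt_atTop x₁).and (eventually_gt_atTop (x₁ - T.re)))).exists
  have e1 := h x (by simpa using h1)
  have e2 := h (x + T) (by simp; linarith)
  refine hx ?_
  have key := (e2.2.1.comp_add_const.eq_of_eventuallyEq_punctured
    (analyticAt_const.mul e1.2.1) (hT x)).self_of_nhds
  simp only [e1.2.2, e2.2.2, Pi.mul_apply] at key
  rw [mul_add, Complex.exp_add, ← mul_assoc] at key
  rw [hF, key, sub_self]

end Translation

section Laurent

variable {a n : ℂ} {f g g₁ g₂ h V V₁ V₂ : ℂ → ℂ}

/-- The Euler operator `ζ d/dζ - n`, describing differentiation of `g ζ / ζ ^ n`. -/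
def eulerOp (n : ℂ) (g : ℂ → ℂ) (ζ : ℂ) : ℂ := ζ * deriv g ζ - n * g ζ

/-- The numerators of the successive derivatives of `g ζ / ζ ^ n`. -/
def eulerIter (n : ℂ) (g : ℂ → ℂ) : ℕ → ℂ → ℂ
  | 0 => g
  | k + 1 => eulerOp (n + k) (eulerIter n g k)

lemma AnalyticAt.eulerIter (hg : AnalyticAt ℂ g 0) (k : ℕ) : AnalyticAt ℂ (eulerIter n g k) 0 := by
  induction k with
  | zero => exact hg
  | succ k ih => exact (analyticAt_id.mul ih.deriv).sub (analyticAt_const.mul ih)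

lemma eulerIter_succ_zero (k : ℕ) : eulerIter n g (k + 1) 0 = -(n + k) * eulerIter n g k 0 := by
  simp only [eulerIter, eulerOp]
  ring

lemma deriv_eventuallyEq_eulerOp (n : ℕ) (hg : AnalyticAt ℂ g 0)
    (hf : f =ᶠ[𝓝[≠] 0] fun ζ => g ζ / ζ ^ n) :
    deriv f =ᶠ[𝓝[≠] 0] fun ζ => eulerOp n g ζ / ζ ^ (n + 1) := by
  have h1 := eventually_eventually_nhdsWithin.2 hf
  filter_upwards [h1, hg.eventually_analyticAt.filter_mono nhdsWithin_le_nhds, self_mem_nhdsWithin]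
    with ζ h1 h2 h3
  have h3 : ζ ≠ 0 := h3
  have h4 : f =ᶠ[𝓝 ζ] fun ζ => g ζ / ζ ^ n := by
    rwa [IsOpen.nhdsWithin_eq isOpen_compl_singleton h3] at h1
  rw [h4.deriv_eq]
  have h5 := (h2.differentiableAt.hasDerivAt.div (hasDerivAt_pow n ζ) (pow_ne_zero n h3)).deriv
  refine Eq.trans h5 ?_
  unfold eulerOp
  rcases n with _ | n
  · simp [h3]
  · rw [Nat.add_sub_cancel]
    field_simp
    ring

lemma iteratedDeriv_eventuallyEq_eulerIter (n : ℕ) (hg : AnalyticAt ℂ g 0)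
    (hf : f =ᶠ[𝓝[≠] 0] fun ζ => g ζ / ζ ^ n) (k : ℕ) :
    iteratedDeriv k f =ᶠ[𝓝[≠] 0] fun ζ => eulerIter n g k ζ / ζ ^ (n + k) := by
  induction k with
  | zero => simpa [eulerIter] using hf
  | succ k ih =>
    rw [iteratedDeriv_succ]
    have := deriv_eventuallyEq_eulerOp (n + k) (hg.eulerIter (n := n) k) ih
    simpa [eulerIter, add_assoc] using this

lemma eulerIter_eventuallyEq_add (m : ℕ) (hg₂ : AnalyticAt ℂ g₂ 0) (hh : AnalyticAt ℂ h 0)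
    (heq : g₁ =ᶠ[𝓝 0] fun ζ => g₂ ζ + ζ ^ m * h ζ) (k : ℕ) :
    eulerIter n g₁ k =ᶠ[𝓝 0] fun ζ => eulerIter n g₂ k ζ + ζ ^ m * eulerIter (n - m) h k ζ := by
  induction k with
  | zero => exact heq
  | succ k ih =>
    filter_upwards [ih, ih.deriv, (hg₂.eulerIter (n := n) k).eventually_analyticAt,
      (hh.eulerIter (n := n - m) k).eventually_analyticAt] with ζ h1 h2 h3 h4
    have h5 := (h3.differentiableAt.hasDerivAt.add
      ((hasDerivAt_pow m ζ).mul h4.differentiableAt.hasDerivAt)).deriv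
    have h6 := h2.trans h5
    simp only [eulerIter, eulerOp]
    rw [h1, h6]
    rcases m with _ | m
    · simp
      ring
    · rw [Nat.add_sub_cancel]
      push_cast
      ring

lemma eq_zero_of_eventually_punctured (hf : ContinuousAt f 0) (h : ∀ᶠ ζ in 𝓝[≠] 0, f ζ = 0) :
    f 0 = 0 :=
  tendsto_nhds_unique (hf.tendsto.mono_left nhdsWithin_le_nhds)
    (tendsto_const_nhds.congr' (h.mono fun _ => Eq.symm))

/-- A pole of a solution is double, with leading coefficient squaring to `-120`. -/
lemma exists_double_pole (hm : MeromorphicAt V 0) (hp : IsPoleAt V 0)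
    (hsol : ∀ᶠ ζ in 𝓝[≠] 0, SatisfiesSH a V ζ) :
    ∃ g : ℂ → ℂ, AnalyticAt ℂ g 0 ∧ g 0 ^ 2 = -120 ∧ V =ᶠ[𝓝[≠] 0] fun ζ => g ζ / ζ ^ 2 := by
  have hneg : meromorphicOrderAt V 0 < 0 := by
    rw [← tendsto_cobounded_iff_meromorphicOrderAt_neg hm]
    exact tendsto_norm_atTop_iff_cobounded.1 hp
  obtain ⟨n, hn⟩ : ∃ n : ℕ, meromorphicOrderAt V 0 = ((-(n : ℤ) : ℤ) : WithTop ℤ) := by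
    lift meromorphicOrderAt V 0 to ℤ using hneg.ne_top with k hk
    have : k < 0 := by exact_mod_cast hneg
    exact ⟨(-k).toNat, by congr 1; omega⟩
  have hn0 : n ≠ 0 := by
    rintro rfl
    rw [hn] at hneg
    simp at hneg
  obtain ⟨g, hg, hg0, hV⟩ := (meromorphicOrderAt_eq_int_iff hm).1 hn
  have hV' : V =ᶠ[𝓝[≠] 0] fun ζ => g ζ / ζ ^ n := by
    filter_upwards [hV] with ζ hζ
    rw [hζ, sub_zero, zpow_neg, zpow_natCast, smul_eq_mul, inv_mul_eq_div]
  have d2 := iteratedDeriv_eventuallyEq_eulerIter n hg hV' 2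
  have d4 := iteratedDeriv_eventuallyEq_eulerIter n hg hV' 4
  have a2 := (hg.eulerIter (n := n) 2).continuousAt
  have a4 := (hg.eulerIter (n := n) 4).continuousAt
  have a0 := hg.continuousAt
  have hode : ∀ᶠ ζ in 𝓝[≠] (0 : ℂ), ζ ≠ 0 ∧ eulerIter n g 4 ζ / ζ ^ (n + 4) +
      a * (eulerIter n g 2 ζ / ζ ^ (n + 2)) + (g ζ / ζ ^ n) ^ 3 - g ζ / ζ ^ n = 0 := by
    filter_upwards [hsol, d2, d4, hV', self_mem_nhdsWithin] with ζ h1 h2 h3 h4 h5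
    unfold SatisfiesSH at h1
    rw [h2, h3, h4] at h1
    exact ⟨h5, h1⟩
  have v4 : eulerIter n g 4 0 = n * (n + 1) * (n + 2) * (n + 3) * g 0 := by
    rw [eulerIter_succ_zero, eulerIter_succ_zero, eulerIter_succ_zero, eulerIter_succ_zero]
    simp only [eulerIter]
    push_cast
    ring
  obtain rfl | rfl | ⟨k, rfl⟩ : n = 1 ∨ n = 2 ∨ ∃ k, n = k + 3 := by
    rcases n with _ | _ | _ | k
    · exact absurd rfl hn0
    · exact Or.inl rfl
    · exact Or.inr (Or.inl rfl)
    · exact Or.inr (Or.inr ⟨k, rfl⟩)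
  · exfalso
    have := eq_zero_of_eventually_punctured (f := fun ζ => eulerIter (1 : ℕ) g 4 ζ +
      a * ζ ^ 2 * eulerIter (1 : ℕ) g 2 ζ + ζ ^ 2 * g ζ ^ 3 - ζ ^ 4 * g ζ) (by fun_prop) (by
        filter_upwards [hode] with ζ ⟨h0, h1⟩
        rw [← mul_zero (ζ ^ 5), ← h1]
        field_simp
        ring)
    simp only [v4] at this
    norm_num at this
    exact hg0 this
  · refine ⟨g, hg, ?_, hV'⟩
    have := eq_zero_of_eventually_punctured (f := fun ζ => eulerIter (2 : ℕ) g 4 ζ +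
      a * ζ ^ 2 * eulerIter (2 : ℕ) g 2 ζ + g ζ ^ 3 - ζ ^ 4 * g ζ) (by fun_prop) (by
        filter_upwards [hode] with ζ ⟨h0, h1⟩
        rw [← mul_zero (ζ ^ 6), ← h1]
        field_simp
        ring)
    simp only [v4] at this
    norm_num at this
    refine mul_left_cancel₀ hg0 ?_
    linear_combination this
  · exfalso
    have := eq_zero_of_eventually_punctured (f := fun ζ =>
      ζ ^ (2 * k + 2) * eulerIter (k + 3 : ℕ) g 4 ζ +
      a * ζ ^ (2 * k + 4) * eulerIter (k + 3 : ℕ) g 2 ζ + g ζ ^ 3 - ζ ^ (2 * k + 6) * g ζ)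
      (by fun_prop) (by
        filter_upwards [hode] with ζ ⟨h0, h1⟩
        rw [← mul_zero (ζ ^ (3 * k + 9)), ← h1]
        field_simp
        ring)
    norm_num at this
    exact hg0 this

/-- The energy determines the Laurent expansion at a pole from its leading coefficient. -/
lemma eventuallyEq_of_shEnergy_eq_zero (hg₁ : AnalyticAt ℂ g₁ 0) (hg₂ : AnalyticAt ℂ g₂ 0)
    (h0 : g₁ 0 = g₂ 0) (hsq : g₂ 0 ^ 2 = -120)
    (hV₁ : V₁ =ᶠ[𝓝[≠] 0] fun ζ => g₁ ζ / ζ ^ 2) (hV₂ : V₂ =ᶠ[𝓝[≠] 0] fun ζ => g₂ ζ / ζ ^ 2)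
    (hE₁ : ∀ᶠ ζ in 𝓝[≠] 0, shEnergy a V₁ ζ = 0) (hE₂ : ∀ᶠ ζ in 𝓝[≠] 0, shEnergy a V₂ ζ = 0) :
    g₁ =ᶠ[𝓝 0] g₂ := by
  have hpoly : ∀ {g V : ℂ → ℂ}, AnalyticAt ℂ g 0 → V =ᶠ[𝓝[≠] 0] (fun ζ => g ζ / ζ ^ 2) →
      (∀ᶠ ζ in 𝓝[≠] 0, shEnergy a V ζ = 0) → ∀ᶠ ζ in 𝓝[≠] 0,
        eulerIter 2 g 1 ζ * eulerIter 2 g 3 ζ - eulerIter 2 g 2 ζ ^ 2 / 2 +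
          a * ζ ^ 2 * eulerIter 2 g 1 ζ ^ 2 / 2 + g ζ ^ 4 / 4 - ζ ^ 4 * g ζ ^ 2 / 2 = 0 := by
    intro g V hg hV hE
    have d := iteratedDeriv_eventuallyEq_eulerIter 2 hg hV
    filter_upwards [hE, d 1, d 2, d 3, hV, self_mem_nhdsWithin] with ζ h1 h2 h3 h4 h5 h6
    have h6 : ζ ≠ 0 := h6
    unfold shEnergy at h1
    rw [h2, h3, h4, h5] at h1
    norm_num at h1
    field_simp at h1
    linear_combination h1 / 8
  rcases (hg₁.sub hg₂).eventually_eq_zero_or_eventually_ne_zero with hz | hz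
  · exact hz.mono fun ζ h => sub_eq_zero.1 h
  exfalso
  obtain ⟨m, h, hh, hη, hd⟩ := (hg₁.sub hg₂).exists_eventuallyEq_pow_smul_nonzero_iff.2 (by
    intro h'
    obtain ⟨ζ, h1, h2⟩ := (hz.and (h'.filter_mono nhdsWithin_le_nhds)).exists
    exact h1 h2)
  have heq : g₁ =ᶠ[𝓝 0] fun ζ => g₂ ζ + ζ ^ m * h ζ := by
    filter_upwards [hd] with ζ hζ
    simp only [Pi.sub_apply, sub_zero, smul_eq_mul] at hζ
    linear_combination hζ
  have hG := eulerIter_eventuallyEq_add (n := 2) m hg₂ hh heq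
  set H := eulerIter (2 - m) h with hH
  have c1 := fun k => (hg₁.eulerIter (n := 2) k).continuousAt
  have c2 := fun k => (hg₂.eulerIter (n := 2) k).continuousAt
  have ch : ∀ k, ContinuousAt (H k) 0 := fun k => (hh.eulerIter (n := 2 - m) k).continuousAt
  have k1 := hg₁.continuousAt
  have k2 := hg₂.continuousAt
  have kh := hh.continuousAt
  have key := eq_zero_of_eventually_punctured (f := fun ζ =>
    H 1 ζ * eulerIter 2 g₁ 3 ζ + eulerIter 2 g₂ 1 ζ * H 3 ζ -
      H 2 ζ * (eulerIter 2 g₁ 2 ζ + eulerIter 2 g₂ 2 ζ) / 2 +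
      a * ζ ^ 2 * H 1 ζ * (eulerIter 2 g₁ 1 ζ + eulerIter 2 g₂ 1 ζ) / 2 +
      h ζ * (g₁ ζ + g₂ ζ) * (g₁ ζ ^ 2 + g₂ ζ ^ 2) / 4 - ζ ^ 4 * h ζ * (g₁ ζ + g₂ ζ) / 2)
    (by have := c1 1; have := c1 2; have := c1 3; have := c2 1; have := c2 2
        have := ch 1; have := ch 2; have := ch 3; fun_prop) (by
      filter_upwards [hpoly hg₁ hV₁ hE₁, hpoly hg₂ hV₂ hE₂,
        (hG 1).filter_mono nhdsWithin_le_nhds, (hG 2).filter_mono nhdsWithin_le_nhds,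
        (hG 3).filter_mono nhdsWithin_le_nhds, heq.filter_mono nhdsWithin_le_nhds,
        self_mem_nhdsWithin] with ζ p1 p2 e1 e2 e3 e0 hζ
      refine (mul_eq_zero.1 ?_).resolve_left (pow_ne_zero m (show ζ ≠ 0 from hζ))
      rw [e1, e2, e3, e0] at p1 ⊢
      linear_combination p1 - p2)
  have vG : ∀ {g : ℂ → ℂ} {n : ℂ}, eulerIter n g 1 0 = -n * g 0 ∧
      eulerIter n g 2 0 = n * (n + 1) * g 0 ∧
      eulerIter n g 3 0 = -(n * (n + 1) * (n + 2)) * g 0 := by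
    intro g n
    simp only [eulerIter_succ_zero]
    simp only [eulerIter]
    push_cast
    refine ⟨?_, ?_, ?_⟩ <;> ring
  simp only [hH, vG.1, vG.2.1, vG.2.2, h0] at key
  have key2 : g₂ 0 * h 0 * ((2 * m * ((m - 3) ^ 2 + 14) + 60 : ℝ) : ℂ) = 0 := by
    push_cast
    linear_combination (-1 : ℂ) * key + (g₂ 0 * h 0) * hsq
  have hg0 : g₂ 0 ≠ 0 := fun h => by norm_num [h] at hsq
  have hpos : (0 : ℝ) < 2 * m * ((m - 3) ^ 2 + 14) + 60 := by positivity
  exact mul_ne_zero (mul_ne_zero hg0 hη) (by exact_mod_cast hpos.ne') key2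

end Laurent

section Poles

variable {a σ p q : ℂ} {U V : ℂ → ℂ}

lemma tendsto_add_const_punctured (z T : ℂ) :
    Tendsto (fun Z => Z + T) (𝓝[≠] z) (𝓝[≠] (z + T)) :=
  tendsto_nhdsWithin_iff.2 ⟨((continuous_id.add continuous_const).tendsto z).mono_left
    nhdsWithin_le_nhds, eventually_nhdsWithin_of_forall fun Z hZ => by simpa using hZ⟩

lemma tendsto_add_const_punctured_zero (p : ℂ) :
    Tendsto (fun ζ => ζ + p) (𝓝[≠] 0) (𝓝[≠] p) := by
  simpa using tendsto_add_const_punctured 0 p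

lemma tendsto_neg_punctured_zero : Tendsto (fun ζ : ℂ => -ζ) (𝓝[≠] 0) (𝓝[≠] 0) :=
  tendsto_nhdsWithin_iff.2 ⟨(continuous_neg.tendsto' (0 : ℂ) 0 neg_zero).mono_left
    nhdsWithin_le_nhds, eventually_nhdsWithin_of_forall fun Z hZ => by simpa using hZ⟩

lemma satisfiesSH_comp_add_const (T z : ℂ) :
    SatisfiesSH a (fun Z => U (Z + T)) z ↔ SatisfiesSH a U (z + T) := by
  simp only [SatisfiesSH, iteratedDeriv_comp_add_const]

lemma shEnergy_comp_add_const (T z : ℂ) :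
    shEnergy a (fun Z => U (Z + T)) z = shEnergy a U (z + T) := by
  simp only [shEnergy, iteratedDeriv_comp_add_const]

lemma shEnergy_comp_neg (z : ℂ) : shEnergy a (fun Z => U (-Z)) z = shEnergy a U (-z) := by
  simp only [shEnergy, iteratedDeriv_comp_neg, smul_eq_mul]
  ring

lemma shEnergy_const_mul (hσ : σ = 1 ∨ σ = -1) (z : ℂ) :
    shEnergy a (fun Z => σ * U Z) z = shEnergy a U z := by
  simp only [shEnergy, iteratedDeriv_const_mul_field]
  rcases hσ with rfl | rfl <;> ring

/-- `g` is the numerator of `U` at the double pole `p`. -/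
def IsPoleNumerator (U : ℂ → ℂ) (p : ℂ) (g : ℂ → ℂ) : Prop :=
  AnalyticAt ℂ g 0 ∧ g 0 ^ 2 = -120 ∧ (fun ζ => U (ζ + p)) =ᶠ[𝓝[≠] 0] fun ζ => g ζ / ζ ^ 2

lemma exists_isPoleNumerator (hm : ∀ z, MeromorphicAt U z)
    (hsol : ∀ z : ℂ, AnalyticAt ℂ U z → SatisfiesSH a U z) (hp : IsPoleAt U p) :
    ∃ g, IsPoleNumerator U p g := by
  refine exists_double_pole (a := a) (hm _).comp_add_const
    (hp.comp (tendsto_add_const_punctured_zero p)) ?_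
  filter_upwards [(tendsto_add_const_punctured_zero p).eventually (hm p).eventually_analyticAt]
    with ζ hζ
  exact (satisfiesSH_comp_add_const p ζ).2 (hsol _ hζ)

variable {g h : ℂ → ℂ}

/-- Solutions of zero energy are even about their poles. -/
lemma IsPoleNumerator.even (hg : IsPoleNumerator U p g)
    (hE : ∀ z, ∀ᶠ y in 𝓝[≠] z, shEnergy a U y = 0) : (fun ζ => g (-ζ)) =ᶠ[𝓝 0] g := by
  have hE0 := (tendsto_add_const_punctured_zero p).eventually (hE p)
  refine eventuallyEq_of_shEnergy_eq_zero (a := a) (V₁ := fun ζ => U (-ζ + p))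
    (AnalyticAt.comp_of_eq (f := fun ζ : ℂ => -ζ) hg.1 (by fun_prop) (by simp)) hg.1 (by simp)
    hg.2.1 ?_ hg.2.2 ?_ ?_
  · filter_upwards [tendsto_neg_punctured_zero.eventually hg.2.2] with ζ hζ
    rw [hζ, neg_sq]
  · filter_upwards [tendsto_neg_punctured_zero.eventually hE0] with ζ hζ
    rw [shEnergy_comp_neg (U := fun ζ => U (ζ + p)), shEnergy_comp_add_const, hζ]
  · filter_upwards [hE0] with ζ hζ
    rw [shEnergy_comp_add_const, hζ]

/-- The difference of two poles is a period or an antiperiod. -/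
lemma IsPoleNumerator.exists_eventually_add (hg : IsPoleNumerator U p g)
    (hh : IsPoleNumerator U q h) (hm : ∀ z, MeromorphicAt U z)
    (hE : ∀ z, ∀ᶠ y in 𝓝[≠] z, shEnergy a U y = 0) :
    ∃ σ : ℂ, (σ = 1 ∨ σ = -1) ∧
      ∀ z, (fun Z => U (Z + (q - p))) =ᶠ[𝓝[≠] z] fun Z => σ * U Z := by
  obtain ⟨σ, hσ, h0⟩ : ∃ σ : ℂ, (σ = 1 ∨ σ = -1) ∧ h 0 = σ * g 0 := by
    rcases sq_eq_sq_iff_eq_or_eq_neg.1 (hh.2.1.trans hg.2.1.symm) with h0 | h0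
    · exact ⟨1, Or.inl rfl, by simpa using h0⟩
    · exact ⟨-1, Or.inr rfl, by simpa using h0⟩
  refine ⟨σ, hσ, fun z => meromorphic_identity (fun z => (hm _).comp_add_const)
    (fun z => (MeromorphicAt.const σ z).mul (hm z)) (z₀ := p) ?_ z⟩
  have key : h =ᶠ[𝓝 0] fun ζ => σ * g ζ := by
    refine eventuallyEq_of_shEnergy_eq_zero (a := a) (V₂ := fun ζ => σ * U (ζ + p)) hh.1
      (analyticAt_const.mul hg.1) h0 ?_ hh.2.2 ?_ ?_ ?_
    · rcases hσ with rfl | rfl <;> simpa using hg.2.1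
    · filter_upwards [hg.2.2] with ζ hζ
      rw [hζ, mul_div_assoc]
    · filter_upwards [(tendsto_add_const_punctured_zero q).eventually (hE q)] with ζ hζ
      rw [shEnergy_comp_add_const, hζ]
    · filter_upwards [(tendsto_add_const_punctured_zero p).eventually (hE p)] with ζ hζ
      rw [shEnergy_const_mul hσ (U := fun ζ => U (ζ + p)), shEnergy_comp_add_const, hζ]
  have ht : Tendsto (fun Z => Z + -p) (𝓝[≠] p) (𝓝[≠] 0) := by
    simpa using tendsto_add_const_punctured p (-p)
  filter_upwards [ht.eventually hg.2.2, ht.eventually hh.2.2,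
    ht.eventually (key.filter_mono nhdsWithin_le_nhds)] with Z h1 h2 h3
  rw [h3] at h2
  rw [neg_add_cancel_right] at h1
  simp only [Pi.mul_apply]
  rw [h1, show Z + (q - p) = Z + -p + q by ring, h2, mul_div_assoc]

end Poles

section Liouville

variable {D : ℂ → ℂ} {C R : ℝ} {T : ℂ}

/-- A Liouville theorem: an antiperiodic function with removable singularities, bounded at both
ends of a period strip, vanishes. -/
lemma eventually_eq_zero_of_antiperiodic (hD : ∀ z, ∃ h, AnalyticAt ℂ h z ∧ D =ᶠ[𝓝[≠] z] h)
    {l : ℝ} (hl : 0 < l) (hT : ∀ z, (fun Z => D (Z + l * I)) =ᶠ[𝓝[≠] z] fun Z => -D Z)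
    (hb : ∀ z : ℂ, R < |z.re| → ∀ᶠ y in 𝓝[≠] z, ‖D y‖ ≤ C) (z : ℂ) :
    D =ᶠ[𝓝[≠] z] 0 := by
  choose h hh hDh using hD
  set E : ℂ → ℂ := fun z => h z z with hE
  have hlim : ∀ z, Tendsto D (𝓝[≠] z) (𝓝 (E z)) := fun z =>
    ((hh z).continuousAt.tendsto.mono_left nhdsWithin_le_nhds).congr' (hDh z).symm
  have hEh : ∀ z, E =ᶠ[𝓝 z] h z := by
    intro z
    have : ∀ᶠ y in 𝓝[≠] z, E y = h z y := by
      filter_upwards [eventually_eventually_nhdsWithin.2 (hDh z),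
        (hh z).eventually_analyticAt.filter_mono nhdsWithin_le_nhds, self_mem_nhdsWithin]
        with y h1 h2 h3
      have h4 : D =ᶠ[𝓝 y] h z := by
        rwa [IsOpen.nhdsWithin_eq isOpen_compl_singleton h3] at h1
      exact tendsto_nhds_unique (hlim y) ((h2.continuousAt.tendsto.mono_left
        nhdsWithin_le_nhds).congr' (h4.symm.filter_mono nhdsWithin_le_nhds))
    rw [eventually_nhdsWithin_iff] at this
    filter_upwards [this] with y hy
    by_cases h : y = z
    · rw [h]
    · exact hy h
  have hEd : Differentiable ℂ E := fun z => ((hh z).congr (hEh z).symm).differentiableAt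
  have hanti : ∀ z, E (z + l * I) = -E z := fun z =>
    tendsto_nhds_unique ((hlim _).comp (tendsto_add_const_punctured z (l * I)))
      ((hlim z).neg.congr' (hT z).symm)
  have hbE : ∀ z : ℂ, R < |z.re| → ‖E z‖ ≤ C := fun z hz => le_of_tendsto (hlim z).norm (hb z hz)
  have hper : Function.Periodic (fun t : ℝ × ℝ => ‖E (t.1 + t.2 * I)‖) (0, l) := by
    intro t
    simp only [Prod.fst_add, Prod.snd_add, add_zero]
    rw [ofReal_add, add_mul, ← add_assoc, hanti, norm_neg]
  obtain ⟨M, hM⟩ := (isCompact_Icc.prod isCompact_Icc : IsCompact (Set.Icc (-R) R ×ˢ Set.Icc 0 l)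
    ).exists_bound_of_continuousOn (f := fun t : ℝ × ℝ => E (t.1 + t.2 * I))
    (hEd.continuous.comp (by fun_prop)).continuousOn
  have hbound : ∀ z, ‖E z‖ ≤ max M C := by
    intro z
    by_cases hz : R < |z.re|
    · exact (hbE z hz).trans (le_max_right _ _)
    have hz' := abs_le.1 (not_lt.1 hz)
    have hp : Function.Periodic (fun y : ℝ => ‖E (z.re + y * I)‖) l := fun y => by
      simpa using hper (z.re, y)
    obtain ⟨y, hy, hy'⟩ := hp.exists_mem_Ico₀ hl z.im
    rw [re_add_im] at hy'
    rw [hy']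
    exact (hM (z.re, y) ⟨hz', Set.Ico_subset_Icc_self hy⟩).trans (le_max_left _ _)
  have hconst := hEd.apply_eq_apply_of_bounded
    (isBounded_iff_forall_norm_le.2 ⟨_, Set.forall_mem_range.2 hbound⟩)
  have hz0 : E z = 0 := by
    have h1 := hanti z
    rw [hconst (z + l * I) z] at h1
    exact CharZero.eq_neg_self_iff.1 h1
  filter_upwards [hDh z, (hEh z).filter_mono nhdsWithin_le_nhds] with y h1 h2
  rw [h1, ← h2, hconst y z, hz0]
  rfl

end Liouville

section Profile

variable {μ ν x₁ x₂ : ℝ} {a c γ σ p T w : ℂ} {U g : ℂ → ℂ}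

/-- The function with double poles at the zeros of `sinh (μ (Z - p))`. -/
def poleProfile (μ : ℝ) (γ p Z : ℂ) : ℂ :=
  γ * μ ^ 2 * Complex.cosh (μ * (Z - p)) / Complex.sinh (μ * (Z - p)) ^ 2

lemma sinh_eq_zero_of_cexp_neg_eq (hσ : σ = 1 ∨ σ = -1) (h : cexp (-w) = σ) :
    Complex.sinh w = 0 ∧ Complex.cosh w = σ := by
  have h' : cexp w = σ := by
    rw [← neg_neg w, Complex.exp_neg, h]
    rcases hσ with rfl | rfl <;> norm_num
  rw [Complex.sinh, Complex.cosh, h, h']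
  constructor <;> ring

lemma cexp_neg_eq_of_sinh_eq_zero (h : Complex.sinh w = 0) :
    cexp (-w) = 1 ∨ cexp (-w) = -1 := by
  refine sq_eq_one_iff.1 ?_
  have h1 : cexp w = cexp (-w) := by
    rw [Complex.sinh, div_eq_zero_iff] at h
    exact sub_eq_zero.1 (h.resolve_right two_ne_zero)
  rw [sq]
  nth_rewrite 1 [← h1]
  rw [← Complex.exp_add, add_neg_cancel, Complex.exp_zero]

lemma poleProfile_add (hσ : σ = 1 ∨ σ = -1) (hT : cexp (-μ * T) = σ) (Z : ℂ) :
    poleProfile μ γ p (Z + T) = σ * poleProfile μ γ p Z := by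
  rw [neg_mul] at hT
  obtain ⟨h1, h2⟩ := sinh_eq_zero_of_cexp_neg_eq hσ hT
  unfold poleProfile
  rw [show μ * (Z + T - p) = μ * (Z - p) + μ * T by ring, Complex.sinh_add,
    Complex.cosh_add, h1, h2]
  rcases hσ with rfl | rfl <;> simp [neg_div]

lemma one_le_norm_sinh (hw : 1 ≤ |w.re|) : 1 ≤ ‖Complex.sinh w‖ := by
  have h1 : |Real.exp w.re - Real.exp (-w.re)| ≤ ‖cexp w - cexp (-w)‖ := by
    simpa [Complex.norm_exp] using abs_norm_sub_norm_le (cexp w) (cexp (-w))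
  have h2 : ‖Complex.sinh w‖ = ‖cexp w - cexp (-w)‖ / 2 := by
    rw [Complex.sinh, norm_div]
    simp
  have h3 : Real.exp w.re - Real.exp (-w.re) = 2 * Real.sinh w.re := by
    rw [Real.sinh_eq]
    ring
  rw [h3, abs_mul, abs_two] at h1
  have h4 : |w.re| ≤ |Real.sinh w.re| := by
    rw [Real.abs_sinh]
    exact Real.self_le_sinh_iff.2 (abs_nonneg _)
  linarith

lemma norm_poleProfile_le {Z : ℂ} (hμ : 0 < μ) (hZ : 1 / μ ≤ |Z.re - p.re|) :
    ‖poleProfile μ γ p Z‖ ≤ 2 * (‖γ‖ * μ ^ 2) := by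
  set w := μ * (Z - p) with hw
  have hre : 1 ≤ |w.re| := by
    rw [hw, re_ofReal_mul, abs_mul, abs_of_pos hμ, sub_re]
    exact (div_le_iff₀' hμ).1 hZ
  have hs := one_le_norm_sinh hre
  have hc : ‖Complex.cosh w‖ ^ 2 ≤ ‖Complex.sinh w‖ ^ 2 + 1 := by
    rw [← norm_pow, Complex.cosh_sq, ← norm_pow]
    exact (norm_add_le _ _).trans_eq (by rw [norm_one])
  have hc' : ‖Complex.cosh w‖ ≤ 2 * ‖Complex.sinh w‖ ^ 2 := by
    have h1 : 1 ≤ ‖Complex.sinh w‖ ^ 2 := one_le_pow₀ hs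
    refine (sq_le_sq₀ (norm_nonneg _) (by positivity)).1 ?_
    nlinarith
  unfold poleProfile
  rw [← hw, norm_div, div_le_iff₀ (by rw [norm_pow]; positivity), norm_mul, norm_mul, norm_pow,
    norm_pow, Complex.norm_real, Real.norm_of_nonneg hμ.le]
  have : 0 ≤ ‖γ‖ * μ ^ 2 := by positivity
  nlinarith [mul_le_mul_of_nonneg_left hc' this]

lemma analyticAt_poleProfile {z : ℂ} (hz : Complex.sinh (μ * (z - p)) ≠ 0) :
    AnalyticAt ℂ (poleProfile μ γ p) z := by
  have h1 : AnalyticAt ℂ (fun Z : ℂ => μ * (Z - p)) z := by fun_prop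
  exact (analyticAt_const.mul (analyticAt_cosh.comp h1)).div ((analyticAt_sinh.comp h1).pow 2)
    (pow_ne_zero 2 hz)

lemma AnalyticAt.exists_eq_mul (hg : AnalyticAt ℂ g 0) (h0 : g 0 = 0) :
    ∃ k : ℂ → ℂ, AnalyticAt ℂ k 0 ∧ k 0 = deriv g 0 ∧ ∀ ζ, g ζ = ζ * k ζ := by
  obtain ⟨P, hP⟩ := hg
  refine ⟨dslope g 0, hP.has_fpower_series_dslope_fslope.analyticAt, dslope_same _ _, fun ζ => ?_⟩
  have := sub_smul_dslope g 0 ζ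
  rw [h0, sub_zero, sub_zero, smul_eq_mul] at this
  exact this.symm

/-- The profile has the same principal part as any even function with a double pole. -/
lemma exists_analyticAt_sub_poleProfile (hμ : 0 < μ) (hg : AnalyticAt ℂ g 0)
    (heven : (fun ζ => g (-ζ)) =ᶠ[𝓝 0] g) :
    ∃ h, AnalyticAt ℂ h 0 ∧
      (fun ζ => g ζ / ζ ^ 2 - poleProfile μ (g 0) p (ζ + p)) =ᶠ[𝓝[≠] 0] h := by
  have hlin : AnalyticAt ℂ (fun ζ : ℂ => μ * ζ) 0 := by fun_prop
  have hcosh : AnalyticAt ℂ (fun ζ : ℂ => Complex.cosh (μ * ζ)) 0 :=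
    analyticAt_cosh.comp hlin
  have hsinh : AnalyticAt ℂ (fun ζ : ℂ => Complex.sinh (μ * ζ)) 0 :=
    analyticAt_sinh.comp hlin
  obtain ⟨s, hs, hs0, hsm⟩ := hsinh.exists_eq_mul (by simp)
  have hs0' : s 0 = μ := by
    rw [hs0]
    have := ((hasDerivAt_id (0 : ℂ)).const_mul (μ : ℂ)).csinh
    simpa using this.deriv
  have hμ' : (μ : ℂ) ≠ 0 := by exact_mod_cast hμ.ne'
  set N : ℂ → ℂ := fun ζ => g ζ * s ζ ^ 2 - g 0 * μ ^ 2 * Complex.cosh (μ * ζ) with hN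
  have hNan : AnalyticAt ℂ N 0 := (hg.mul (hs.pow 2)).sub (analyticAt_const.mul hcosh)
  have hseven : ∀ ζ, s (-ζ) = s ζ := by
    intro ζ
    rcases eq_or_ne ζ 0 with rfl | hζ
    · simp
    have h1 := hsm (-ζ)
    rw [mul_neg, Complex.sinh_neg, hsm ζ] at h1
    exact mul_left_cancel₀ hζ (by linear_combination h1)
  have hNeven : (fun ζ => N (-ζ)) =ᶠ[𝓝 0] N := by
    filter_upwards [heven] with ζ hζ
    simp only [hN, hζ, hseven, mul_neg, Complex.cosh_neg]
  have hN' : deriv N 0 = 0 := by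
    have h1 := hNeven.deriv_eq
    rw [deriv_comp_neg, neg_zero] at h1
    exact CharZero.neg_eq_self_iff.1 h1
  obtain ⟨k, hk, hk0, hNk⟩ := hNan.exists_eq_mul (by simp [hN, hs0'])
  obtain ⟨k', hk', -, hkk'⟩ := hk.exists_eq_mul (hk0.trans hN')
  refine ⟨fun ζ => k' ζ / s ζ ^ 2, hk'.div (hs.pow 2) (by simp [hs0', hμ']), ?_⟩
  have hsne : ∀ᶠ ζ in 𝓝[≠] 0, s ζ ≠ 0 :=
    (hs.continuousAt.eventually_ne (by rwa [hs0'])).filter_mono nhdsWithin_le_nhds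
  filter_upwards [hsne, self_mem_nhdsWithin] with ζ h1 h2
  have h2 : ζ ≠ 0 := h2
  have h3 := hNk ζ
  rw [hkk' ζ] at h3
  simp only [hN] at h3
  unfold poleProfile
  rw [add_sub_cancel_right, hsm ζ]
  generalize Complex.cosh (μ * ζ) = C at h3 ⊢
  field_simp
  linear_combination h3

end Profile

section ClosedForm

variable {μ ν x₁ x₂ : ℝ} {a c : ℂ} {U : ℂ → ℂ}

lemma cexp_neg_mul_antiperiod (hμ : 0 < μ) : cexp (-μ * ((Real.pi / μ : ℝ) * I)) = -1 := by
  have hμ' : (μ : ℂ) ≠ 0 := by exact_mod_cast hμ.ne'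
  rw [show -(μ : ℂ) * ((Real.pi / μ : ℝ) * I) = -(Real.pi * I) by push_cast; field_simp,
    Complex.exp_neg, exp_pi_mul_I]
  norm_num

/-- The Liouville argument for functions on the plane that are bounded at both ends. -/
lemma eq_zero_of_bounded_ends (hμ : 0 < μ) {D : ℂ → ℂ} {C R : ℝ}
    (hD : ∀ z, ∃ h, AnalyticAt ℂ h z ∧ D =ᶠ[𝓝[≠] z] h)
    (hadd : ∀ z T σ : ℂ, (σ = 1 ∨ σ = -1) → cexp (-μ * T) = σ →
      (fun Z => D (Z + T)) =ᶠ[𝓝[≠] z] fun Z => σ * D Z)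
    (hb : ∀ z : ℂ, R < |z.re| → ‖D z‖ ≤ C) (z : ℂ) : D =ᶠ[𝓝[≠] z] 0 := by
  refine eventually_eq_zero_of_antiperiodic hD (l := Real.pi / μ) (by positivity)
    (fun z => (hadd z _ (-1) (Or.inr rfl) (cexp_neg_mul_antiperiod hμ)).trans ?_)
    (C := C) (R := R) (fun z hz => ?_) z
  · exact .of_forall fun Z => neg_one_mul _
  · have : ∀ᶠ y : ℂ in 𝓝 z, R < |y.re| := (isOpen_lt continuous_const (by fun_prop)).mem_nhds hz
    exact (this.filter_mono nhdsWithin_le_nhds).mono hb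

lemma exists_eventuallyEq_poleProfile (hmer : MeromorphicOnPlane U)
    (hsol : ∀ z : ℂ, AnalyticAt ℂ U z → SatisfiesSH a U z)
    (hE : ∀ z, ∀ᶠ y in 𝓝[≠] z, shEnergy a U y = 0) (hμ : 0 < μ) (hμν : μ * ν = 1)
    (hrep : IsStableRep μ ν U c x₁) (hc : c ≠ 0) (hb : ∀ Z : ℂ, Z.re < x₂ → ‖U Z‖ ≤ 1)
    (hU : ¬ ∀ z, U =ᶠ[𝓝[≠] z] 0) :
    ∃ p γ : ℂ, γ ^ 2 = -120 ∧ ∀ z, U =ᶠ[𝓝[≠] z] poleProfile μ γ p := by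
  have hm := hmer.meromorphicAt
  have hadd := fun (z T σ : ℂ) hσ hT => hrep.eventually_add (σ := σ) (T := T) hm hμ hσ hT z
  have hbU : ∀ z : ℂ, max |x₁| |x₂| < |z.re| → ‖U z‖ ≤ 1 := by
    intro z hz
    obtain ⟨h1, h2⟩ := max_lt_iff.1 hz
    rcases le_total 0 z.re with h | h
    · rw [abs_of_nonneg h] at h1
      exact hrep.norm_le_one hμν ((le_abs_self _).trans_lt h1)
    · rw [abs_of_nonpos h] at h2
      exact hb z (by linarith [neg_abs_le x₂])
  obtain ⟨p, hp⟩ : ∃ p, IsPoleAt U p := by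
    by_contra! hno
    exact hU (eq_zero_of_bounded_ends hμ
      (fun z => ⟨U, (hmer z).resolve_right (hno z), .rfl⟩) hadd hbU)
  obtain ⟨g, hg⟩ := exists_isPoleNumerator hm hsol hp
  refine ⟨p, g 0, hg.2.1, ?_⟩
  set S := poleProfile μ (g 0) p with hS
  have haddD : ∀ z T σ : ℂ, (σ = 1 ∨ σ = -1) → cexp (-μ * T) = σ →
      (fun Z => U (Z + T) - S (Z + T)) =ᶠ[𝓝[≠] z] fun Z => σ * (U Z - S Z) := by
    intro z T σ hσ hT
    filter_upwards [hadd z T σ hσ hT] with Z hZ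
    rw [hZ, hS, poleProfile_add hσ hT, mul_sub]
  have hbD : ∀ z : ℂ, max |x₁| |x₂| + |p.re| + 1 / μ < |z.re| →
      ‖U z - S z‖ ≤ 1 + 2 * (‖g 0‖ * μ ^ 2) := by
    intro z hz
    have h1 : 0 ≤ |p.re| := abs_nonneg _
    have h2 : 0 < 1 / μ := by positivity
    have h3 : 0 ≤ max |x₁| |x₂| := le_max_of_le_left (abs_nonneg _)
    refine (norm_sub_le _ _).trans (add_le_add (hbU z (by linarith)) (norm_poleProfile_le hμ ?_))
    linarith [abs_sub_abs_le_abs_sub z.re p.re]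
  have hDp : ∃ h, AnalyticAt ℂ h 0 ∧ (fun ζ => U (ζ + p) - S (ζ + p)) =ᶠ[𝓝[≠] 0] h := by
    obtain ⟨h, hh, hd⟩ := exists_analyticAt_sub_poleProfile (p := p) hμ hg.1 (hg.even hE)
    refine ⟨h, hh, ?_⟩
    filter_upwards [hd, hg.2.2] with ζ h1 h2
    rw [h2, ← h1]
  have hrem : ∀ z, ∃ h, AnalyticAt ℂ h z ∧ (fun Z => U Z - S Z) =ᶠ[𝓝[≠] z] h := by
    intro z
    by_cases hz : Complex.sinh (μ * (z - p)) = 0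
    · obtain ⟨h, hh, hd⟩ := hDp
      have hσ := cexp_neg_eq_of_sinh_eq_zero hz
      set σ := cexp (-(μ * (z - p))) with hσ'
      have ht := tendsto_add_const_punctured z (-z)
      have ht' := tendsto_add_const_punctured z (p - z)
      rw [add_neg_cancel] at ht
      rw [add_sub_cancel] at ht'
      refine ⟨fun Z => σ * h (Z + -z), analyticAt_const.mul
        (AnalyticAt.comp_add_const (by rwa [add_neg_cancel])), ?_⟩
      filter_upwards [ht.eventually hd, ht'.eventually
        (haddD p (z - p) σ hσ (by rw [hσ', neg_mul]))] with Z h1 h2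
      rw [← h1, show Z + -z + p = Z + (p - z) by ring, ← h2,
        show Z + (p - z) + (z - p) = Z by ring]
    · refine ⟨_, ((hmer z).resolve_right fun hz' => hz ?_).sub (analyticAt_poleProfile hz), .rfl⟩
      obtain ⟨g', hg'⟩ := exists_isPoleNumerator hm hsol hz'
      obtain ⟨σ, hσ, hT⟩ := hg.exists_eventually_add hg' hm hE
      have := hrep.cexp_eq hμ hμν hc hT
      rw [neg_mul] at this
      exact (sinh_eq_zero_of_cexp_neg_eq hσ this).1
  intro z
  exact (eq_zero_of_bounded_ends hμ hrem haddD hbD z).mono fun Z hZ => sub_eq_zero.1 hZ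

end ClosedForm

section RealForm

variable {μ ν a A x₀ : ℝ} {p γ : ℂ} {U : ℂ → ℂ}

lemma exists_real_profile (hU : ∀ x : ℝ, AnalyticAt ℂ U x) (hreal : ∀ x : ℝ, (U x).im = 0)
    (hμ : 0 < μ) (hγ : γ ^ 2 = -120) (h : ∀ z, U =ᶠ[𝓝[≠] z] poleProfile μ γ p) :
    ∃ A x₀ : ℝ, A ^ 2 = 120 * μ ^ 4 ∧ ∀ x : ℝ,
      U x = ((A * Real.sinh (μ * (x - x₀)) / Real.cosh (μ * (x - x₀)) ^ 2 : ℝ) : ℂ) := by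
  have hμ' : (μ : ℂ) ≠ 0 := by exact_mod_cast hμ.ne'
  have hprod : ∀ x : ℝ, U x * Complex.sinh (μ * (x - p)) ^ 2 =
      γ * μ ^ 2 * Complex.cosh (μ * (x - p)) := by
    intro x
    have h1 : AnalyticAt ℂ (fun Z : ℂ => μ * (Z - p)) x := by fun_prop
    have h2 : AnalyticAt ℂ (fun Z : ℂ => Complex.sinh (μ * (Z - p))) x := analyticAt_sinh.comp h1
    have h3 : AnalyticAt ℂ (fun Z : ℂ => Complex.cosh (μ * (Z - p))) x := analyticAt_cosh.comp h1
    refine (((hU x).mul (h2.pow 2)).eq_of_eventuallyEq_punctured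
      (analyticAt_const (v := γ * μ ^ 2) |>.mul h3) ?_).self_of_nhds
    have hne : ∀ᶠ Z in 𝓝[≠] (x : ℂ), Complex.sinh (μ * (Z - p)) ≠ 0 := by
      refine h2.eventually_eq_zero_or_eventually_ne_zero.resolve_left fun h0 => ?_
      have h4 : AnalyticOnNhd ℂ (fun Z : ℂ => Complex.sinh (μ * (Z - p))) Set.univ := fun z _ =>
        analyticAt_sinh.comp (f := fun Z : ℂ => μ * (Z - p)) (by fun_prop)
      have h5 := congrFun (h4.eq_of_eventuallyEq (g := 0) (fun _ _ => analyticAt_const) h0)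
        (p + 1 / μ)
      have h6 : Complex.sinh (1 : ℂ) = 0 := by
        simpa [hμ'] using h5
      have h7 : Real.sinh 1 = 0 := by
        rwa [← ofReal_one, ← ofReal_sinh, ofReal_eq_zero] at h6
      exact one_ne_zero (Real.sinh_eq_zero.1 h7)
    filter_upwards [h x, hne] with Z h5 h6
    simp only [Pi.mul_apply, Pi.pow_apply]
    rw [h5, poleProfile, div_mul_cancel₀ _ (pow_ne_zero 2 h6)]
  obtain ⟨γi, rfl⟩ : ∃ γi : ℝ, γ = γi * I := by
    have h1 := congrArg Complex.re hγ
    have h2 := congrArg Complex.im hγ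
    simp [sq] at h1 h2
    have h3 : γ.re = 0 := by
      by_contra h3
      have : γ.im = 0 := (mul_eq_zero.1 (by linarith : γ.re * γ.im = 0)).resolve_left h3
      rw [this] at h1
      nlinarith [mul_self_nonneg γ.re]
    exact ⟨γ.im, by rw [← re_add_im γ]; simp [h3]⟩
  have hγi : γi ^ 2 = 120 := by
    have : ((γi ^ 2 : ℝ) : ℂ) = (120 : ℝ) := by
      push_cast
      rw [mul_pow, I_sq] at hγ
      linear_combination -hγ
    exact_mod_cast this
  have hθ : ∀ x : ℝ, (μ : ℂ) * (x - p) =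
      ((μ * (x - p.re) : ℝ) : ℂ) + ((-(μ * p.im) : ℝ) : ℂ) * I := by
    intro x
    nth_rewrite 1 [← re_add_im p]
    push_cast
    ring
  have hS : ∀ x : ℝ, Complex.sinh (μ * (x - p)) = Real.sinh (μ * (x - p.re)) * Real.cos (μ * p.im) -
      Real.cosh (μ * (x - p.re)) * Real.sin (μ * p.im) * I := by
    intro x
    rw [hθ, Complex.sinh_add, Complex.cosh_mul_I, Complex.sinh_mul_I]
    push_cast
    rw [Complex.cos_neg, Complex.sin_neg]
    ring
  have hC : ∀ x : ℝ, Complex.cosh (μ * (x - p)) = Real.cosh (μ * (x - p.re)) * Real.cos (μ * p.im) -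
      Real.sinh (μ * (x - p.re)) * Real.sin (μ * p.im) * I := by
    intro x
    rw [hθ, Complex.cosh_add, Complex.cosh_mul_I, Complex.sinh_mul_I]
    push_cast
    rw [Complex.cos_neg, Complex.sin_neg]
    ring
  have hUr : ∀ x : ℝ, U x = ((U x).re : ℝ) := fun x => Complex.ext rfl (by simp [hreal])
  have hcos : Real.cos (μ * p.im) = 0 := by
    have h1 := hprod p.re
    rw [hS, hC, hUr] at h1
    simp only [sub_self, mul_zero, Real.sinh_zero, Real.cosh_zero] at h1
    generalize Real.cos (μ * p.im) = C at *
    generalize Real.sin (μ * p.im) = s at *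
    have h2 := congrArg Complex.im h1
    simp [sq] at h2
    rcases h2 with (h2 | h2) | h2
    · norm_num [h2] at hγi
    · exact absurd h2 hμ.ne'
    · exact h2
  have hsin : Real.sin (μ * p.im) ^ 2 = 1 := by
    have := Real.sin_sq_add_cos_sq (μ * p.im)
    rw [hcos] at this
    linarith
  refine ⟨-(γi * Real.sin (μ * p.im) * μ ^ 2), p.re, ?_, fun x => ?_⟩
  · linear_combination Real.sin (μ * p.im) ^ 2 * μ ^ 4 * hγi + 120 * μ ^ 4 * hsin
  have h1 := hprod x
  rw [hS, hC, hcos] at h1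
  have hne : ((Real.cosh (μ * (x - p.re)) : ℝ) : ℂ) ≠ 0 := by
    exact_mod_cast (Real.cosh_pos _).ne'
  have hsin' : ((Real.sin (μ * p.im) : ℝ) : ℂ) ^ 2 = 1 := by exact_mod_cast hsin
  generalize Real.sin (μ * p.im) = s at *
  generalize Real.cosh (μ * (x - p.re)) = C at *
  generalize Real.sinh (μ * (x - p.re)) = S at *
  push_cast at h1 ⊢
  rw [eq_div_iff (pow_ne_zero 2 hne)]
  linear_combination -h1 - U x * C ^ 2 * hsin' + (U x * C ^ 2 * s ^ 2 + γi * μ ^ 2 * S * s) * I_sq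

/-- Vanishing energy fixes the parameter for which the profile solves the equation. -/
lemma eq_mul_sq_of_jetEnergy_eq_zero {u : ℕ → ℝ → ℝ} (hu : IsJetSolution a Set.univ u)
    (hA : A ≠ 0) (hμ : 0 < μ)
    (h : ∀ x, u 0 x = A * Real.sinh (μ * (x - x₀)) / Real.cosh (μ * (x - x₀)) ^ 2)
    (hE : jetEnergy a u x₀ = 0) : a = 10 * μ ^ 2 := by
  have hlin : ∀ x : ℝ, HasDerivAt (fun x => μ * (x - x₀)) μ x := fun x => by
    simpa using ((hasDerivAt_id x).sub_const x₀).const_mul μ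
  have hS : ∀ x, HasDerivAt (fun x => Real.sinh (μ * (x - x₀))) _ x := fun x => (hlin x).sinh
  have hC : ∀ x, HasDerivAt (fun x => Real.cosh (μ * (x - x₀))) _ x := fun x => (hlin x).cosh
  have hC0 : ∀ x, Real.cosh (μ * (x - x₀)) ≠ 0 := fun x => (Real.cosh_pos _).ne'
  have hCS : ∀ x, Real.cosh (μ * (x - x₀)) ^ 2 = Real.sinh (μ * (x - x₀)) ^ 2 + 1 := fun x =>
    Real.cosh_sq _
  have h1 : ∀ x, u 1 x =
      A * μ * (2 - Real.cosh (μ * (x - x₀)) ^ 2) / Real.cosh (μ * (x - x₀)) ^ 3 := by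
    intro x
    have e := hu.hasDerivAt_zero x trivial
    rw [funext h] at e
    refine e.unique ((((hS x).const_mul A).div ((hC x).pow 2) (pow_ne_zero 2
      (hC0 x))).congr_deriv ?_)
    have h0 := hC0 x
    have h2 := hCS x
    simp only [Pi.pow_apply]
    generalize Real.cosh (μ * (x - x₀)) = C at h0 h2 ⊢
    generalize Real.sinh (μ * (x - x₀)) = S at h2 ⊢
    simp
    field_simp
    linear_combination (2 : ℝ) * h2
  have h2 : ∀ x, u 2 x = A * μ ^ 2 * (Real.sinh (μ * (x - x₀)) *
      (Real.cosh (μ * (x - x₀)) ^ 2 - 6)) / Real.cosh (μ * (x - x₀)) ^ 4 := by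
    intro x
    have e := hu.hasDerivAt_one x trivial
    rw [funext h1] at e
    refine e.unique (((((hC x).pow 2).const_sub 2).const_mul (A * μ)).div ((hC x).pow 3)
      (pow_ne_zero 3 (hC0 x)) |>.congr_deriv ?_)
    have h0 := hC0 x
    simp only [Pi.pow_apply]
    generalize Real.cosh (μ * (x - x₀)) = C at h0 ⊢
    generalize Real.sinh (μ * (x - x₀)) = S
    simp
    field_simp
    ring
  have h3 : u 3 x₀ = -5 * A * μ ^ 3 := by
    have e := hu.hasDerivAt_two x₀ trivial
    rw [funext h2] at e
    refine e.unique ((((hS x₀).mul (((hC x₀).pow 2).sub_const 6)).const_mul (A * μ ^ 2)).div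
      ((hC x₀).pow 4) (pow_ne_zero 4 (hC0 x₀)) |>.congr_deriv ?_)
    simp
    ring
  unfold jetEnergy at hE
  rw [h, h1, h2, h3] at hE
  simp at hE
  have : A ^ 2 * μ ^ 2 * (a - 10 * μ ^ 2) = 0 := by linear_combination 2 * hE
  have h0 : A ^ 2 * μ ^ 2 ≠ 0 := by positivity
  exact sub_eq_zero.1 ((mul_eq_zero.1 this).resolve_left h0)

lemma two_mul_kSH_pow_four : (2 * kSH) ^ 4 = 1 / 11 := by
  have : ((11 : ℝ) ^ ((1 : ℝ) / 4)) ^ 4 = 11 := by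
    rw [← Real.rpow_natCast, ← Real.rpow_mul (by norm_num)]
    norm_num
  rw [kSH, mul_one_div, div_pow, mul_pow, this]
  norm_num

lemma USH_eq (Z : ℝ) : USH Z = 2 * Real.sqrt 30 / Real.sqrt 11 *
    (Real.sinh (2 * kSH * Z) / Real.cosh (2 * kSH * Z) ^ 2) := by
  unfold USH
  rw [mul_assoc 2, Real.sinh_two_mul, Real.cosh_two_mul, Real.tanh_eq_sinh_div_cosh]
  have h1 := Real.cosh_sq (kSH * Z)
  have h2 := (Real.cosh_pos (kSH * Z)).ne'
  generalize Real.cosh (kSH * Z) = C at *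
  generalize Real.sinh (kSH * Z) = S at *
  have h3 : C ^ 2 + S ^ 2 ≠ 0 := by positivity
  have h4 : Real.sqrt 11 ≠ 0 := by positivity
  have h5 : 1 + (S / C) ^ 2 ≠ 0 := by positivity
  field_simp
  rw [h1]
  ring

end RealForm

section Reflection

variable {a : ℂ} {U : ℂ → ℂ}

lemma satisfiesSH_comp_neg (z : ℂ) :
    SatisfiesSH a (fun Z => U (-Z)) z ↔ SatisfiesSH a U (-z) := by
  simp only [SatisfiesSH, iteratedDeriv_comp_neg, smul_eq_mul]
  norm_num

lemma analyticAt_comp_neg {z : ℂ} : AnalyticAt ℂ (fun Z => U (-Z)) z ↔ AnalyticAt ℂ U (-z) := by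
  constructor <;> intro h
  · simpa [Function.comp_def] using
      AnalyticAt.comp_of_eq (f := fun Z : ℂ => -Z) (x := -z) h (by fun_prop) (neg_neg z)
  · exact AnalyticAt.comp_of_eq (f := fun Z : ℂ => -Z) h (by fun_prop) rfl

lemma MeromorphicOnPlane.comp_neg (hU : MeromorphicOnPlane U) :
    MeromorphicOnPlane fun Z => U (-Z) := by
  refine fun z => (hU (-z)).imp analyticAt_comp_neg.2 fun h => h.comp ?_
  exact tendsto_nhdsWithin_iff.2 ⟨(continuous_neg.tendsto z).mono_left nhdsWithin_le_nhds,
    eventually_nhdsWithin_of_forall fun Z hZ => by simpa using hZ⟩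

end Reflection

/-- The exponents of the linearization at `0`. -/
lemma exists_exponents (a : ℝ) : ∃ μ ν : ℝ, 0 < μ ∧ 0 < ν ∧ μ * ν = 1 ∧ a = ν ^ 2 - μ ^ 2 := by
  have h1 : |a| < Real.sqrt (a ^ 2 + 4) := by
    rw [← Real.sqrt_sq_eq_abs]
    exact Real.sqrt_lt_sqrt (sq_nonneg a) (by linarith)
  have h2 := Real.sq_sqrt (by positivity : 0 ≤ a ^ 2 + 4)
  set s := Real.sqrt (a ^ 2 + 4)
  have h3 : 0 < (s - a) / 2 := by linarith [le_abs_self a]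
  have h4 : 0 < (s + a) / 2 := by linarith [neg_abs_le a]
  refine ⟨Real.sqrt ((s - a) / 2), Real.sqrt ((s + a) / 2), Real.sqrt_pos.2 h3, Real.sqrt_pos.2 h4,
    ?_, ?_⟩
  · rw [← Real.sqrt_mul h3.le, Real.sqrt_eq_one]
    linear_combination h2 / 4
  · rw [Real.sq_sqrt h3.le, Real.sq_sqrt h4.le]
    ring

/-- Up to translation and sign, the stationary Swift–Hohenberg equation has exactly one
meromorphic homoclinic solution, and it exists only for `a = 10/√11`. -/
theorem unique_meromorphic_homoclinic_solution
    (a : ℝ) (U : ℂ → ℂ)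
    (hmer : MeromorphicOnPlane U)
    (hsol : ∀ z : ℂ, AnalyticAt ℂ U z → SatisfiesSH (a : ℂ) U z)
    (hnc : ∃ z₁ z₂ : ℂ, AnalyticAt ℂ U z₁ ∧ AnalyticAt ℂ U z₂ ∧ U z₁ ≠ U z₂)
    (hnopole : ∀ x : ℝ, ¬ IsPoleAt U (x : ℂ))
    (hreal : ∀ x : ℝ, (U (x : ℂ)).im = 0)
    (htop : Tendsto (fun x : ℝ => U (x : ℂ)) atTop (𝓝 0))
    (hbot : Tendsto (fun x : ℝ => U (x : ℂ)) atBot (𝓝 0)) :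
    a = 10 / Real.sqrt 11 ∧
      ∃ ε : ℝ, (ε = 1 ∨ ε = -1) ∧ ∃ Z₀ : ℝ,
        ∀ Z : ℝ, U (Z : ℂ) = ((ε * USH (Z - Z₀) : ℝ) : ℂ) := by
  obtain ⟨μ, ν, hμ, hν, hμν, ha⟩ := exists_exponents a
  have hm := hmer.meromorphicAt
  have hU : ∀ x : ℝ, AnalyticAt ℂ U x := fun x => (hmer x).resolve_right (hnopole x)
  have hJ := isJetSolution_realJet hU hreal hsol
  have hdecay : Tendsto (realJet U 0) atTop (𝓝 0) := by
    have h1 := (continuous_re.tendsto 0).comp htop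
    rw [zero_re] at h1
    exact h1.congr fun x => by simp [realJet]
  have hJE := hJ.jetEnergy_eq_zero hμ hν hμν ha hdecay
  have hE := eventually_shEnergy_eq_zero (a := a) hm hU
    (fun x => by rw [shEnergy_ofReal hU hreal, hJE, ofReal_zero])
  obtain ⟨c, x₁, hrep⟩ := exists_isStableRep hmer hU hreal hsol htop hμ hν hμν ha
  obtain ⟨c', x₂, hrep'⟩ := exists_isStableRep (U := fun Z => U (-Z)) hmer.comp_neg
    (fun x => analyticAt_comp_neg.2 (by simpa using hU (-x))) (fun x => by simpa using hreal (-x))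
    (fun z hz => (satisfiesSH_comp_neg z).2 (hsol _ (analyticAt_comp_neg.1 hz)))
    (by simpa [Function.comp_def] using hbot.comp tendsto_neg_atTop_atBot) hμ hν hμν ha
  have hU0 : ¬ ∀ z, U =ᶠ[𝓝[≠] z] 0 := by
    intro h
    obtain ⟨z₁, z₂, h1, h2, hne⟩ := hnc
    have hval : ∀ z, AnalyticAt ℂ U z → U z = 0 := fun z hz =>
      (hz.eq_of_eventuallyEq_punctured analyticAt_const (h z)).self_of_nhds
    exact hne ((hval z₁ h1).trans (hval z₂ h2).symm)
  have hc : c ≠ 0 := by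
    rintro rfl
    refine hU0 (meromorphic_identity hm (fun z => MeromorphicAt.const 0 z)
      (z₀ := ((x₁ + 1 : ℝ) : ℂ)) ?_)
    have hopen : ∀ᶠ Z in 𝓝 ((x₁ + 1 : ℝ) : ℂ), x₁ < Z.re :=
      (isOpen_lt continuous_const continuous_re).mem_nhds (by simp)
    filter_upwards [hopen.filter_mono nhdsWithin_le_nhds] with Z hZ
    rw [(hrep Z hZ).2.2, zero_mul, oddSeries_zero]
    rfl
  have hleft : ∀ Z : ℂ, Z.re < -x₂ → ‖U Z‖ ≤ 1 := fun Z hZ => by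
    simpa using hrep'.norm_le_one hμν (Z := -Z) (by rw [neg_re]; linarith)
  obtain ⟨p, γ, hγ, hprof⟩ := exists_eventuallyEq_poleProfile hmer hsol hE hμ hμν hrep hc hleft hU0
  obtain ⟨A, x₀, hA, hform⟩ := exists_real_profile hU hreal hμ hγ hprof
  have hA0 : A ≠ 0 := by
    rintro rfl
    have : 0 < μ ^ 4 := by positivity
    linarith
  have ha' : a = 10 * μ ^ 2 := by
    refine eq_mul_sq_of_jetEnergy_eq_zero hJ hA0 hμ (fun x => ?_) (hJE x₀)
    simp only [realJet, iteratedDeriv_zero, hform x, ofReal_re]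
  have hμ4 : μ ^ 4 = 1 / 11 := by
    linear_combination (-μ ^ 2 / 11) * ha' + (μ ^ 2 / 11) * ha + (μ * ν + 1) / 11 * hμν
  have hk : 0 < kSH := by
    unfold kSH
    positivity
  have hμk : μ = 2 * kSH :=
    (pow_left_inj₀ hμ.le (by positivity) four_ne_zero).1 (hμ4.trans two_mul_kSH_pow_four.symm)
  have h11 : 0 < Real.sqrt 11 := by positivity
  have h11' : Real.sqrt 11 ^ 2 = 11 := Real.sq_sqrt (by norm_num)
  have h30 : Real.sqrt 30 ^ 2 = 30 := Real.sq_sqrt (by norm_num)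
  have hμ2 : μ ^ 2 = 1 / Real.sqrt 11 := by
    refine (pow_left_inj₀ (by positivity) (by positivity) two_ne_zero).1 ?_
    rw [div_pow, h11', one_pow, ← hμ4]
    ring
  refine ⟨by rw [ha', hμ2, mul_one_div], ?_⟩
  obtain ⟨ε, hε, hAε⟩ : ∃ ε : ℝ, (ε = 1 ∨ ε = -1) ∧
      A = ε * (2 * Real.sqrt 30 / Real.sqrt 11) := by
    have : A ^ 2 = (2 * Real.sqrt 30 / Real.sqrt 11) ^ 2 := by
      rw [hA, hμ4, div_pow, mul_pow, h30, h11']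
      norm_num
    rcases sq_eq_sq_iff_eq_or_eq_neg.1 this with h | h
    · exact ⟨1, Or.inl rfl, by rw [h, one_mul]⟩
    · exact ⟨-1, Or.inr rfl, by rw [h, neg_one_mul]⟩
  refine ⟨ε, hε, x₀, fun Z => ?_⟩
  rw [hform, USH_eq, hμk, hAε, mul_div_assoc, mul_assoc]

end
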